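/- For all integers k ≥ 1, l ≥ 1 and all x, y ∈ ℝ, lim_{n→∞} P( M̃_n^{(k)} ≤ u_n(x), M̂_n^{(l)} ≤ u_n(y) ) = ∑_{s=0}^{k−1} ∑_{t=0}^{l−1} E ∫_{−∞}^{+∞} [ (λ g(x,z))^s / s! · exp(−λ g(x,z)) · ((1−λ) g(y,z))^t / t! · exp(−(1−λ) g(y,z)) ] dΦ(z). -/

import Mathlib

open MeasureTheory ProbabilityTheory Filter Real
open scoped Classical NNReal ENNReal

/-- The normalizing levels `u_n(x) = x/a_n + b_n` with `a_n = (2 ln n)^{1/2}` and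
`b_n = a_n - (ln ln n + ln (4π))/(2 a_n)`. -/
noncomputable def un (n : ℕ) (x : ℝ) : ℝ :=
  x / Real.sqrt (2 * Real.log n) +
    (Real.sqrt (2 * Real.log n) -
      (Real.log (Real.log n) + Real.log (4 * Real.pi)) / (2 * Real.sqrt (2 * Real.log n)))

/-- `g(x,z) = exp(-x - γ + √(2γ) z)`. -/
noncomputable def g (γ x z : ℝ) : ℝ := Real.exp (-x - γ + Real.sqrt (2 * γ) * z)

/-- `G` is bounded and differentiable with bounded continuous partial derivatives `D i`. -/
def HasBddPartials {ι : Type*} [Fintype ι] (G : (ι → ℝ) → ℝ) (D : ι → (ι → ℝ) → ℝ) : Prop :=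
  (∃ C, ∀ z, |G z| ≤ C) ∧ (∀ i, Continuous (D i)) ∧ (∀ i, ∃ C, ∀ z, |D i z| ≤ C) ∧
    ∀ z, HasFDerivAt G (∑ i, D i z • (ContinuousLinearMap.proj i : (ι → ℝ) →L[ℝ] ℝ)) z

lemma HasBddPartials.continuous {ι : Type*} [Fintype ι] {G : (ι → ℝ) → ℝ}
    {D : ι → (ι → ℝ) → ℝ} (h : HasBddPartials G D) : Continuous G :=
  continuous_iff_continuousAt.2 fun z => (h.2.2.2 z).continuousAt

lemma HasBddPartials.hasDerivAt_comp {ι : Type*} [Fintype ι] {G : (ι → ℝ) → ℝ}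
    {D : ι → (ι → ℝ) → ℝ} (h : HasBddPartials G D) {c : ℝ → ι → ℝ} {c' : ι → ℝ} {t : ℝ}
    (hc : HasDerivAt c c' t) :
    HasDerivAt (fun s => G (c s)) (∑ i, D i (c t) * c' i) t := by
  simpa [Function.comp_def] using (h.2.2.2 (c t)).comp_hasDerivAt t hc

lemma hasDerivAt_gaussianPDFReal (m : ℝ) (v : ℝ≥0) (x : ℝ) :
    HasDerivAt (gaussianPDFReal m v) (-((x - m) / v) * gaussianPDFReal m v x) x := by
  unfold gaussianPDFReal
  have h1 : HasDerivAt (fun x : ℝ => -(x - m) ^ 2 / (2 * v)) (-(x - m) / v) x := by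
    refine (((((hasDerivAt_id' x).sub_const m).fun_pow 2).fun_neg).div_const
      (2 * (v : ℝ))).congr_deriv ?_
    by_cases hv : (v : ℝ) = 0
    · simp [hv]
    · field_simp; norm_num; ring
  refine ((h1.exp).const_mul ((√(2 * π * v))⁻¹)).congr_deriv ?_
  ring

lemma continuous_gaussianPDFReal (m : ℝ) (v : ℝ≥0) : Continuous (gaussianPDFReal m v) :=
  continuous_iff_continuousAt.2 fun x => (hasDerivAt_gaussianPDFReal m v x).continuousAt

lemma integrable_id_gaussianReal (m : ℝ) (v : ℝ≥0) :
    Integrable (fun x : ℝ => x) (gaussianReal m v) :=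
  memLp_one_iff_integrable.1 (memLp_id_gaussianReal 1)

lemma integrable_gaussianReal_iff {m : ℝ} {v : ℝ≥0} (hv : v ≠ 0) {f : ℝ → ℝ} :
    Integrable f (gaussianReal m v) ↔ Integrable (fun x => gaussianPDFReal m v x * f x) := by
  rw [gaussianReal_of_var_ne_zero _ hv, integrable_withDensity_iff_integrable_smul₀'
    (measurable_gaussianPDF m v).aemeasurable (ae_of_all _ fun x => gaussianPDF_lt_top)]
  simp [toReal_gaussianPDF]

/-- Stein's identity. -/
lemma integral_id_mul_gaussianReal (v : ℝ≥0) {f f' : ℝ → ℝ}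
    (hf : ∀ x, HasDerivAt f (f' x) x) (hf'c : Continuous f') {C : ℝ}
    (hC : ∀ x, |f x| ≤ C) {C' : ℝ} (hC' : ∀ x, |f' x| ≤ C') :
    ∫ x, x * f x ∂(gaussianReal 0 v) = v * ∫ x, f' x ∂(gaussianReal 0 v) := by
  by_cases hv : v = 0
  · simp [hv]
  have hv' : (v : ℝ) ≠ 0 := by exact_mod_cast hv
  have hfc : Continuous f := continuous_iff_continuousAt.2 fun x => (hf x).continuousAt
  rw [integral_gaussianReal_eq_integral_smul hv, integral_gaussianReal_eq_integral_smul hv]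
  have i1 : Integrable (fun x => x * f x) (gaussianReal 0 v) := by
    refine (integrable_id_gaussianReal 0 v).mul_bdd (c := C) hfc.aestronglyMeasurable ?_
    exact ae_of_all _ fun x => by simpa using hC x
  have i2 : Integrable f (gaussianReal 0 v) :=
    Integrable.of_bound hfc.aestronglyMeasurable C (ae_of_all _ fun x => by simpa using hC x)
  have i3 : Integrable f' (gaussianReal 0 v) :=
    Integrable.of_bound hf'c.aestronglyMeasurable C' (ae_of_all _ fun x => by simpa using hC' x)
  rw [integrable_gaussianReal_iff hv] at i1 i2 i3
  have key := integral_mul_deriv_eq_deriv_mul_of_integrable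
    (u := f) (u' := f') (v := gaussianPDFReal 0 v)
    (v' := fun x => -((x - 0) / v) * gaussianPDFReal 0 v x)
    (fun x _ => hf x) (fun x _ => hasDerivAt_gaussianPDFReal 0 v x)
    (by
      convert i1.const_mul (-(1 / (v : ℝ))) using 1
      ext x; simp; ring)
    (by convert i3 using 1; ext x; simp; ring)
    (by convert i2 using 1; ext x; simp; ring)
  have e1 : ∫ x, gaussianPDFReal 0 v x • (x * f x)
      = -v * ∫ x, f x * (-((x - 0) / v) * gaussianPDFReal 0 v x) := by
    rw [← integral_const_mul]
    congr 1; ext x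
    simp; field_simp
  have e2 : ∫ x, f' x * gaussianPDFReal 0 v x = ∫ x, gaussianPDFReal 0 v x • f' x := by
    congr 1; ext x; simp; ring
  rw [e1, key, e2]; ring

section Gaussian
variable {Ω : Type*} [MeasurableSpace Ω] {P : Measure Ω} {ι : Type*} [Fintype ι]

/-- Gaussian integration by parts. -/
lemma gaussian_integral_mul_comp {Y : Ω → ℝ} {Z : Ω → ι → ℝ}
    (hYZ : HasGaussianLaw (fun ω => (Y ω, Z ω)) P) (hY : ∫ ω, Y ω ∂P = 0)
    {G : (ι → ℝ) → ℝ} {D : ι → (ι → ℝ) → ℝ} (hG : HasBddPartials G D) :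
    ∫ ω, Y ω * G (Z ω) ∂P = ∑ j, cov[Y, fun ω => Z ω j; P] * ∫ ω, D j (Z ω) ∂P := by
  have hprob := hYZ.isProbabilityMeasure
  have hYg : HasGaussianLaw Y P := hYZ.fst
  have hZg : HasGaussianLaw Z P := hYZ.snd
  have hZj : ∀ j, HasGaussianLaw (fun ω => Z ω j) P := fun j => hZg.eval j
  have hYm := hYg.aemeasurable
  have hZm := hZg.aemeasurable
  set v := Var[Y; P] with hv
  have hv0 : 0 ≤ v := variance_nonneg _ _
  by_cases hvz : v = 0
  · have hY0 : Y =ᵐ[P] 0 := by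
      have h := hYg.map_eq_gaussianReal
      rw [hY, ← hv, hvz] at h
      simp only [Real.toNNReal_zero, gaussianReal_zero_var] at h
      have : ∀ᵐ y ∂(P.map Y), y = 0 := by rw [h]; simp
      exact ae_of_ae_map hYm this
    have hcov : ∀ j, cov[Y, fun ω => Z ω j; P] = 0 := by
      intro j
      rw [covariance, hY]
      rw [integral_congr_ae (g := fun _ => 0)]
      · simp
      · filter_upwards [hY0] with ω h; simp [h]
    simp only [hcov, zero_mul, Finset.sum_const_zero]
    rw [integral_congr_ae (g := fun _ => 0)]
    · simp
    · filter_upwards [hY0] with ω h; simp [h]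
  set c : ι → ℝ := fun j => cov[Y, fun ω => Z ω j; P] / v with hc
  set R : Ω → ι → ℝ := fun ω j => Z ω j - c j * Y ω with hR
  have hYR' : HasGaussianLaw (fun ω => ((fun _ : Unit => Y ω), (fun j => R ω j))) P := by
    have := hYZ.map_fun
      ((ContinuousLinearMap.pi fun _ : Unit => ContinuousLinearMap.fst ℝ ℝ (ι → ℝ)).prod
        (ContinuousLinearMap.pi fun j => (ContinuousLinearMap.proj j).comp
          (ContinuousLinearMap.snd ℝ ℝ (ι → ℝ)) - c j • ContinuousLinearMap.fst ℝ ℝ (ι → ℝ)))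
    exact this
  have hind : IndepFun Y R P := by
    have h := HasGaussianLaw.indepFun_of_covariance_eval (X := fun _ : Unit => Y)
      (Y := fun j ω => R ω j) hYR' (fun _ j => by
        have : cov[Y, fun ω => Z ω j - c j * Y ω; P] = 0 := by
          rw [covariance_fun_sub_right hYg.memLp_two (hZj j).memLp_two
            (hYg.memLp_two.const_mul _), covariance_const_mul_right, covariance_self hYm, ← hv, hc]
          field_simp
          simp
        exact this)
    exact h.comp (φ := fun f : Unit → ℝ => f ()) (ψ := id) (measurable_pi_apply _) measurable_id
  have hRg : HasGaussianLaw R P := hYR'.snd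
  have hRm := hRg.aemeasurable
  have hlaw := (indepFun_iff_map_prod_eq_prod_map_map hYm hRm).1 hind
  have hYlaw : P.map Y = gaussianReal 0 v.toNNReal := by rw [hYg.map_eq_gaussianReal, hY]
  have hGc := hG.continuous
  obtain ⟨⟨C, hC⟩, hDc, hDb, -⟩ := id hG
  choose K hK using hDb
  have hprobY : IsProbabilityMeasure (P.map Y) := Measure.isProbabilityMeasure_map hYm
  have hprobR : IsProbabilityMeasure (P.map R) := Measure.isProbabilityMeasure_map hRm
  have hsplit : ∀ (H : ℝ × (ι → ℝ) → ℝ), Continuous H → Integrable H ((P.map Y).prod (P.map R)) →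
      ∫ ω, H (Y ω, R ω) ∂P = ∫ r, ∫ y, H (y, r) ∂(P.map Y) ∂(P.map R) := by
    intro H hH hi
    rw [← integral_prod_symm _ hi, ← hlaw, integral_map (hYm.prodMk hRm)
      (by exact hH.aestronglyMeasurable)]
  have hZ : ∀ ω, Z ω = fun j => R ω j + c j * Y ω := by intro ω; ext j; simp [hR]
  have hline : Continuous fun p : ℝ × (ι → ℝ) => fun j => p.2 j + c j * p.1 := by fun_prop
  have hDint : ∀ j, ∫ ω, D j (Z ω) ∂P
      = ∫ r, ∫ y, D j (fun j => r j + c j * y) ∂(P.map Y) ∂(P.map R) := by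
    intro j
    have h1 : Continuous (fun p : ℝ × (ι → ℝ) => D j (fun j => p.2 j + c j * p.1)) :=
      (hDc j).comp hline
    rw [← hsplit (fun p : ℝ × (ι → ℝ) => D j (fun j => p.2 j + c j * p.1)) h1
      (Integrable.of_bound h1.aestronglyMeasurable (K j) (ae_of_all _ fun p => hK j _))]
    simp_rw [hZ]
  have hLint : ∫ ω, Y ω * G (Z ω) ∂P
      = ∫ r, ∫ y, y * G (fun j => r j + c j * y) ∂(P.map Y) ∂(P.map R) := by
    have h1 : Continuous (fun p : ℝ × (ι → ℝ) => G (fun j => p.2 j + c j * p.1)) :=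
      hGc.comp hline
    rw [← hsplit (fun p : ℝ × (ι → ℝ) => p.1 * G (fun j => p.2 j + c j * p.1))
      (continuous_fst.mul h1) ?_]
    · simp_rw [hZ]
    · refine Integrable.mul_bdd (c := C) ?_ h1.aestronglyMeasurable (ae_of_all _ fun p => hC _)
      have : Integrable (fun y : ℝ => y) (P.map Y) := by
        rw [hYlaw]; exact integrable_id_gaussianReal _ _
      exact this.comp_fst (P.map R)
  rw [hLint]
  simp_rw [hDint, ← integral_const_mul]
  rw [← integral_finsetSum]
  · congr 1; ext r
    have hst := integral_id_mul_gaussianReal v.toNNReal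
      (f := fun y => G (fun j => r j + c j * y))
      (f' := fun y => ∑ j, D j (fun j => r j + c j * y) * c j)
      (fun y => hG.hasDerivAt_comp (c := fun y j => r j + c j * y) (c' := c) (t := y) (by
        rw [hasDerivAt_pi]; intro j
        simpa using ((hasDerivAt_id y).const_mul (c j)).const_add (r j)))
      (by
        refine continuous_finsetSum _ fun j _ => ((hDc j).comp ?_).mul continuous_const
        fun_prop)
      (fun y => hC _) (C' := ∑ j, K j * |c j|) (fun y => by
        refine (Finset.abs_sum_le_sum_abs _ _).trans (Finset.sum_le_sum fun j _ => ?_)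
        rw [abs_mul]; gcongr; exact hK _ _)
    rw [hYlaw, hst, integral_finsetSum, Finset.mul_sum]
    · refine Finset.sum_congr rfl fun j _ => ?_
      rw [integral_mul_const, integral_const_mul, Real.coe_toNNReal _ hv0, hc]
      field_simp
    · intro j _
      refine Integrable.mul_const ?_ _
      refine Integrable.of_bound (C := K j) (Continuous.aestronglyMeasurable ?_)
        (ae_of_all _ fun p => hK j _)
      refine (hDc j).comp ?_
      fun_prop
  · intro j _
    simp_rw [integral_const_mul]
    refine Integrable.const_mul ?_ _
    have h1 : Continuous (fun p : (ι → ℝ) × ℝ => D j (fun j => p.1 j + c j * p.2)) :=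
      (hDc j).comp (by fun_prop)
    have := (Integrable.of_bound (μ := (P.map R).prod (P.map Y)) h1.aestronglyMeasurable (K j)
      (ae_of_all _ fun p => hK j _)).integral_prod_left
    exact this

end Gaussian

section Gaussian
variable {Ω : Type*} [MeasurableSpace Ω] {P : Measure Ω} {ι : Type*} [Fintype ι]

lemma covariance_fun_add_left [IsFiniteMeasure P] {X Y Z : Ω → ℝ} (hX : MemLp X 2 P)
    (hY : MemLp Y 2 P) (hZ : MemLp Z 2 P) :
    cov[fun ω => X ω + Y ω, Z; P] = cov[X, Z; P] + cov[Y, Z; P] :=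
  covariance_add_left hX hY hZ

lemma covariance_fun_add_right [IsFiniteMeasure P] {X Y Z : Ω → ℝ} (hX : MemLp X 2 P)
    (hY : MemLp Y 2 P) (hZ : MemLp Z 2 P) :
    cov[X, fun ω => Y ω + Z ω; P] = cov[X, Y; P] + cov[X, Z; P] :=
  covariance_add_right hX hY hZ

/-- Normal comparison along the circular interpolation `sin θ V + cos θ W`. -/
lemma gaussian_comparison {V W : Ω → ι → ℝ}
    (hVW : HasGaussianLaw (fun ω => (V ω, W ω)) P)
    (hVm : Measurable V) (hWm : Measurable W)
    (hV0 : ∀ i, ∫ ω, V ω i ∂P = 0) (hW0 : ∀ i, ∫ ω, W ω i ∂P = 0)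
    (hcov : ∀ i j, cov[fun ω => V ω i, fun ω => W ω j; P] = 0)
    {F : (ι → ℝ) → ℝ} {D : ι → (ι → ℝ) → ℝ} {D2 : ι → ι → (ι → ℝ) → ℝ}
    (hF : HasBddPartials F D) (hD : ∀ i, HasBddPartials (D i) (D2 i)) {B : ℝ}
    (hB : ∀ θ : ℝ, |∑ i, ∑ j, (cov[fun ω => V ω i, fun ω => V ω j; P]
        - cov[fun ω => W ω i, fun ω => W ω j; P]) *
      ∫ ω, D2 i j (fun k => sin θ * V ω k + cos θ * W ω k) ∂P| ≤ B) :
    |∫ ω, F (V ω) ∂P - ∫ ω, F (W ω) ∂P| ≤ B := by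
  have hprob := hVW.isProbabilityMeasure
  have hVg : HasGaussianLaw V P := hVW.fst
  have hWg : HasGaussianLaw W P := hVW.snd
  have hVi : ∀ i, HasGaussianLaw (fun ω => V ω i) P := fun i => hVg.eval i
  have hWi : ∀ i, HasGaussianLaw (fun ω => W ω i) P := fun i => hWg.eval i
  have hVim : ∀ i, Measurable fun ω => V ω i := fun i => (measurable_pi_apply i).comp hVm
  have hWim : ∀ i, Measurable fun ω => W ω i := fun i => (measurable_pi_apply i).comp hWm
  set Z : ℝ → Ω → ι → ℝ := fun θ ω k => sin θ * V ω k + cos θ * W ω k with hZ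
  set Z' : ℝ → Ω → ι → ℝ := fun θ ω k => cos θ * V ω k - sin θ * W ω k with hZ'
  have hZm : ∀ θ, Measurable (Z θ) := fun θ => by
    rw [measurable_pi_iff]; intro k
    exact ((hVim k).const_mul _).add ((hWim k).const_mul _)
  have hFc := hF.continuous
  obtain ⟨⟨C, hC⟩, hDc, hDb, -⟩ := id hF
  choose K hK using hDb
  have hderiv : ∀ θ, HasDerivAt (fun θ => ∫ ω, F (Z θ ω) ∂P)
      (∫ ω, ∑ i, D i (Z θ ω) * Z' θ ω i ∂P) θ := by
    intro θ
    refine (hasDerivAt_integral_of_dominated_loc_of_deriv_le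
      (F := fun θ ω => F (Z θ ω)) (F' := fun θ ω => ∑ i, D i (Z θ ω) * Z' θ ω i)
      (bound := fun ω => ∑ i, K i * (|V ω i| + |W ω i|)) (s := Set.univ) Filter.univ_mem
      (Eventually.of_forall fun θ => (hFc.measurable.comp (hZm θ)).aestronglyMeasurable)
      (Integrable.of_bound (hFc.measurable.comp (hZm θ)).aestronglyMeasurable C
        (ae_of_all _ fun ω => hC _)) ?_ ?_ ?_ ?_).2
    · refine (Finset.measurable_fun_sum _ fun i _ => ?_).aestronglyMeasurable
      exact ((hDc i).measurable.comp (hZm θ)).mul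
        (((hVim i).const_mul _).sub ((hWim i).const_mul _))
    · refine ae_of_all _ fun ω t _ => ?_
      refine (Finset.abs_sum_le_sum_abs _ _).trans (Finset.sum_le_sum fun i _ => ?_)
      rw [abs_mul]
      have h1 : |Z' t ω i| ≤ |V ω i| + |W ω i| := by
        refine (abs_sub _ _).trans ?_
        rw [abs_mul, abs_mul]
        have := mul_le_mul_of_nonneg_right (abs_cos_le_one t) (abs_nonneg (V ω i))
        have := mul_le_mul_of_nonneg_right (abs_sin_le_one t) (abs_nonneg (W ω i))
        linarith
      exact mul_le_mul (hK i _) h1 (abs_nonneg _) ((abs_nonneg _).trans (hK i 0))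
    · refine integrable_finsetSum _ fun i _ => Integrable.const_mul ?_ _
      exact (hVi i).integrable.abs.add (hWi i).integrable.abs
    · refine ae_of_all _ fun ω t _ => ?_
      refine hF.hasDerivAt_comp (c := fun t => Z t ω) ?_
      rw [hasDerivAt_pi]; intro k
      refine (((hasDerivAt_sin t).mul_const (V ω k)).add
        ((hasDerivAt_cos t).mul_const (W ω k))).congr_deriv ?_
      simp only [hZ']; ring
  have hcovW : ∀ i j, cov[fun ω => W ω i, fun ω => V ω j; P] = 0 := fun i j => by
    rw [covariance_comm]; exact hcov j i
  have hmain : ∀ θ, ∫ ω, ∑ i, D i (Z θ ω) * Z' θ ω i ∂P = sin θ * cos θ *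
      ∑ i, ∑ j, (cov[fun ω => V ω i, fun ω => V ω j; P]
        - cov[fun ω => W ω i, fun ω => W ω j; P]) * ∫ ω, D2 i j (Z θ ω) ∂P := by
    intro θ
    have hZi' : ∀ i, MemLp (fun ω => Z' θ ω i) 2 P := fun i =>
      ((hVi i).memLp_two.const_mul _).sub ((hWi i).memLp_two.const_mul _)
    rw [integral_finsetSum]
    · rw [Finset.mul_sum]
      refine Finset.sum_congr rfl fun i _ => ?_
      have hpair : HasGaussianLaw (fun ω => (Z' θ ω i, Z θ ω)) P := by
        have := hVW.map_fun
          ((cos θ • (ContinuousLinearMap.proj i).comp (ContinuousLinearMap.fst ℝ (ι → ℝ) (ι → ℝ)) -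
            sin θ • (ContinuousLinearMap.proj i).comp
              (ContinuousLinearMap.snd ℝ (ι → ℝ) (ι → ℝ))).prod
           (sin θ • ContinuousLinearMap.fst ℝ (ι → ℝ) (ι → ℝ) +
            cos θ • ContinuousLinearMap.snd ℝ (ι → ℝ) (ι → ℝ)))
        exact this
      have h0 : ∫ ω, Z' θ ω i ∂P = 0 := by
        simp only [hZ']
        rw [integral_sub ((hVi i).integrable.const_mul _) ((hWi i).integrable.const_mul _),
          integral_const_mul, integral_const_mul, hV0, hW0]
        simp
      have := gaussian_integral_mul_comp hpair h0 (hD i)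
      simp_rw [mul_comm (D i _)]
      rw [this, Finset.mul_sum]
      refine Finset.sum_congr rfl fun j _ => ?_
      have : cov[fun ω => Z' θ ω i, fun ω => Z θ ω j; P] = sin θ * cos θ *
          (cov[fun ω => V ω i, fun ω => V ω j; P]
            - cov[fun ω => W ω i, fun ω => W ω j; P]) := by
        simp only [hZ', hZ]
        have a1 := (hVi i).memLp_two
        have a2 := (hVi j).memLp_two
        have a3 := (hWi i).memLp_two
        have a4 := (hWi j).memLp_two
        have a5 : MemLp (fun ω => sin θ * V ω j + cos θ * W ω j) 2 P :=
          (a2.const_mul _).add (a4.const_mul _)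
        rw [covariance_fun_sub_left (a1.const_mul _) (a3.const_mul _) a5,
          covariance_fun_add_right (a1.const_mul _) (a2.const_mul _) (a4.const_mul _),
          covariance_fun_add_right (a3.const_mul _) (a2.const_mul _) (a4.const_mul _)]
        simp only [covariance_const_mul_left, covariance_const_mul_right, hcov, hcovW]
        ring
      rw [this]; ring
    · intro i _
      refine Integrable.bdd_mul (c := K i) ((hZi' i).integrable (by norm_num))
        ((hDc i).measurable.comp (hZm θ)).aestronglyMeasurable (ae_of_all _ fun ω => hK i _)
  have hB0 : 0 ≤ B := (abs_nonneg _).trans (hB 0)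
  have hmv := Convex.norm_image_sub_le_of_norm_hasDerivWithin_le
    (f := fun θ => ∫ ω, F (Z θ ω) ∂P) (s := Set.univ) (x := 0) (y := π / 2) (C := B / 2)
    (fun θ _ => (hderiv θ).hasDerivWithinAt) (fun θ _ => by
      rw [hmain, norm_mul]
      have h1 : ‖sin θ * cos θ‖ ≤ 1 / 2 := by
        rw [Real.norm_eq_abs, abs_le]
        constructor <;> nlinarith [sin_sq_add_cos_sq θ, sq_nonneg (sin θ + cos θ),
          sq_nonneg (sin θ - cos θ)]
      calc _ ≤ 1 / 2 * B := mul_le_mul h1 (hB θ) (abs_nonneg _) (by norm_num)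
        _ = B / 2 := by ring) convex_univ (Set.mem_univ _) (Set.mem_univ _)
  have e1 : Z (π / 2) = V := by ext ω k; simp [hZ]
  have e0 : Z 0 = W := by ext ω k; simp [hZ]
  simp only [e1, e0] at hmv
  refine hmv.trans ?_
  rw [Real.norm_eq_abs, sub_zero, abs_of_pos (by positivity)]
  nlinarith [pi_le_four]

end Gaussian

lemma hasBddPartials_prod {ι : Type*} [Fintype ι] {h h' : ι → ℝ → ℝ}
    (hh : ∀ k x, HasDerivAt (h k) (h' k x) x) (hc : ∀ k, Continuous (h' k))
    (hb : ∀ k, ∃ C, ∀ x, |h k x| ≤ C) (hb' : ∀ k, ∃ C, ∀ x, |h' k x| ≤ C) :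
    HasBddPartials (fun z : ι → ℝ => ∏ k, h k (z k))
      (fun i z => ∏ k, Function.update h i (h' i) k (z k)) := by
  have bdd : ∀ f : ι → ℝ → ℝ, (∀ k, ∃ C, ∀ x, |f k x| ≤ C) →
      ∃ C, ∀ z : ι → ℝ, |∏ k, f k (z k)| ≤ C := by
    intro f hf
    choose C hC using hf
    refine ⟨∏ k, C k, fun z => ?_⟩
    rw [Finset.abs_prod]
    exact Finset.prod_le_prod (fun _ _ => abs_nonneg _) fun k _ => hC k _
  have hcont : ∀ k, Continuous (h k) := fun k =>
    continuous_iff_continuousAt.2 fun x => (hh k x).continuousAt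
  refine ⟨bdd h hb, fun i => ?_, fun i => bdd _ fun k => ?_, fun z => ?_⟩
  · refine continuous_finsetProd _ fun k _ => ?_
    have : Continuous (Function.update h i (h' i) k) := by
      by_cases hk : k = i
      · subst hk; simpa using hc k
      · simpa [Function.update_of_ne hk] using hcont k
    exact this.comp (continuous_apply k)
  · by_cases hk : k = i
    · subst hk; simpa using hb' k
    · simpa [Function.update_of_ne hk] using hb k
  · have := HasFDerivAt.finsetProd (u := Finset.univ) (x := z)
      (g := fun k (z : ι → ℝ) => h k (z k))
      (g' := fun k => h' k (z k) • (ContinuousLinearMap.proj k : (ι → ℝ) →L[ℝ] ℝ))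
      (fun k _ => (hh k (z k)).comp_hasFDerivAt z
        (ContinuousLinearMap.proj k : (ι → ℝ) →L[ℝ] ℝ).hasFDerivAt)
    refine this.congr_fderiv ?_
    refine Finset.sum_congr rfl fun i _ => ?_
    rw [smul_smul]
    congr 1
    change _ = ∏ k, Function.update h i (h' i) k (z k)
    rw [← Finset.mul_prod_erase Finset.univ _ (Finset.mem_univ i), mul_comm]
    simp only [Function.update_self]
    congr 1
    refine Finset.prod_congr rfl fun k hk => ?_
    rw [Function.update_of_ne (Finset.ne_of_mem_erase hk)]

lemma integral_gaussianPDFReal_sub {v t : ℝ≥0} (hv : v ≠ 0) (ht : t ≠ 0) (c : ℝ) :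
    ∫ s, gaussianPDFReal 0 t (s - c) ∂(gaussianReal 0 v) = gaussianPDFReal 0 (v + t) c := by
  rw [integral_gaussianReal_eq_integral_smul hv]
  have hv' : (0 : ℝ) < v := by exact_mod_cast pos_iff_ne_zero.2 hv
  have ht' : (0 : ℝ) < t := by exact_mod_cast pos_iff_ne_zero.2 ht
  have hq : v * t / (v + t) ≠ 0 := by positivity
  have key : ∀ s, gaussianPDFReal 0 v s • gaussianPDFReal 0 t (s - c) =
      gaussianPDFReal 0 (v + t) c * gaussianPDFReal (v * c / (v + t)) (v * t / (v + t)) s := by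
    intro s
    simp only [gaussianPDFReal, smul_eq_mul]
    push_cast
    rw [mul_mul_mul_comm, mul_mul_mul_comm _ (rexp _), ← mul_inv, ← mul_inv, ← Real.exp_add,
      ← Real.exp_add, ← Real.sqrt_mul (by positivity), ← Real.sqrt_mul (by positivity)]
    refine congrArg₂ (· * ·) (congrArg (fun x => (√x)⁻¹) ?_) (congrArg rexp ?_)
    · field_simp
    · field_simp
      ring
  simp_rw [key]
  rw [integral_const_mul, integral_gaussianPDFReal_eq_one _ hq, mul_one]

lemma gaussianPDFReal_mul_gaussianPDFReal {t : ℝ≥0} (ht : t ≠ 0) (x y : ℝ) :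
    gaussianPDFReal 0 t x * gaussianPDFReal 0 t y =
      2 * (gaussianPDFReal 0 (2 * t) (x + y) * gaussianPDFReal 0 (2 * t) (x - y)) := by
  have ht' : (0 : ℝ) < t := by exact_mod_cast pos_iff_ne_zero.2 ht
  simp only [gaussianPDFReal]
  push_cast
  rw [mul_mul_mul_comm, mul_mul_mul_comm _ (rexp _), ← mul_inv, ← mul_inv, ← Real.exp_add,
      ← Real.exp_add, ← Real.sqrt_mul (by positivity), ← Real.sqrt_mul (by positivity)]
  have e : √(2 * π * (2 * t) * (2 * π * (2 * t))) = 2 * √(2 * π * t * (2 * π * t)) := by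
    rw [Real.sqrt_mul_self (by positivity), Real.sqrt_mul_self (by positivity)]; ring
  have e' : -(x - 0) ^ 2 / (2 * (t : ℝ)) + -(y - 0) ^ 2 / (2 * t) =
      -(x + y - 0) ^ 2 / (2 * (2 * t)) + -(x - y - 0) ^ 2 / (2 * (2 * t)) := by
    field_simp
    ring
  rw [e, e', mul_inv]
  ring

lemma gaussianPDFReal_le (m : ℝ) (v : ℝ≥0) (x : ℝ) :
    gaussianPDFReal m v x ≤ (√(2 * π * v))⁻¹ := by
  rw [gaussianPDFReal]
  refine mul_le_of_le_one_right (by positivity) ?_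
  rw [Real.exp_le_one_iff, neg_div]
  simp only [Left.neg_nonpos_iff]
  positivity

section Gaussian
variable {Ω : Type*} [MeasurableSpace Ω] {P : Measure Ω}

lemma integral_gaussianPDFReal_mul_le {A B : Ω → ℝ}
    (hAB : HasGaussianLaw (fun ω => (A ω, B ω)) P)
    (hA0 : ∫ ω, A ω ∂P = 0) (hB0 : ∫ ω, B ω ∂P = 0) (hA1 : Var[A; P] = 1) (hB1 : Var[B; P] = 1)
    {w : ℝ} (hw : |cov[A, B; P]| ≤ w) (hw1 : w < 1) {t : ℝ≥0} (ht : t ≠ 0) {a b u : ℝ}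
    (hu0 : 0 ≤ u) (hua : u ≤ a) (hub : u ≤ b) :
    ∫ ω, gaussianPDFReal 0 t (A ω - a) * gaussianPDFReal 0 t (B ω - b) ∂P ≤
      exp (-(u ^ 2 / (1 + w + t))) / √(1 - w ^ 2) := by
  have hprob := hAB.isProbabilityMeasure
  set ρ := cov[A, B; P] with hρ
  have hρw := abs_le.1 hw
  have hAg := hAB.fst
  have hBg := hAB.snd
  have mA := hAg.memLp_two
  have mB := hBg.memLp_two
  set S : Ω → ℝ := fun ω => A ω + B ω with hS
  set D : Ω → ℝ := fun ω => A ω - B ω with hD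
  have hSD : HasGaussianLaw (fun ω => (S ω, D ω)) P := by
    have := hAB.map_fun ((ContinuousLinearMap.fst ℝ ℝ ℝ + ContinuousLinearMap.snd ℝ ℝ ℝ).prod
      (ContinuousLinearMap.fst ℝ ℝ ℝ - ContinuousLinearMap.snd ℝ ℝ ℝ))
    exact this
  have hBA : cov[B, A; P] = ρ := by rw [hρ, covariance_comm]
  have hAA : cov[A, A; P] = 1 := by rw [covariance_self hAg.aemeasurable, hA1]
  have hBB : cov[B, B; P] = 1 := by rw [covariance_self hBg.aemeasurable, hB1]
  have hcovAny : ∀ {Y : Ω → ℝ}, MemLp Y 2 P → cov[S, Y; P] = cov[A, Y; P] + cov[B, Y; P] :=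
    fun hY => covariance_fun_add_left mA mB hY
  have hind : IndepFun S D P := by
    refine hSD.indepFun_of_covariance_eq_zero ?_
    rw [hcovAny hSD.snd.memLp_two, covariance_fun_sub_right mA mA mB,
      covariance_fun_sub_right mB mA mB, hBA, hAA, hBB, ← hρ]
    ring
  have hVS : Var[S; P] = 2 + 2 * ρ := by
    rw [← covariance_self hSD.fst.aemeasurable, hcovAny hSD.fst.memLp_two,
      covariance_fun_add_right mA mA mB, covariance_fun_add_right mB mA mB, hBA, hAA, hBB, ← hρ]
    ring
  have hVD : Var[D; P] = 2 - 2 * ρ := by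
    rw [← covariance_self hSD.snd.aemeasurable, hD,
      covariance_fun_sub_right hSD.snd.memLp_two mA mB, covariance_fun_sub_left mA mB mA,
      covariance_fun_sub_left mA mB mB, hBA, hAA, hBB, ← hρ]
    ring
  have hSlaw : P.map S = gaussianReal 0 (2 + 2 * ρ).toNNReal := by
    rw [hSD.fst.map_eq_gaussianReal, hVS]
    simp [hS, integral_add hAg.integrable hBg.integrable, hA0, hB0]
  have hDlaw : P.map D = gaussianReal 0 (2 - 2 * ρ).toNNReal := by
    rw [hSD.snd.map_eq_gaussianReal, hVD]
    simp [hD, integral_sub hAg.integrable hBg.integrable, hA0, hB0]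
  have h1 : ∀ ω, gaussianPDFReal 0 t (A ω - a) * gaussianPDFReal 0 t (B ω - b) =
      2 * (gaussianPDFReal 0 (2 * t) (S ω - (a + b)) *
        gaussianPDFReal 0 (2 * t) (D ω - (a - b))) := by
    intro ω
    rw [gaussianPDFReal_mul_gaussianPDFReal ht]
    simp only [hS, hD]
    congr 3 <;> ring
  simp_rw [h1]
  have hmeas : ∀ c : ℝ, Measurable fun s => gaussianPDFReal 0 (2 * t) (s - c) := fun c =>
    (measurable_gaussianPDFReal _ _).comp (measurable_id.sub_const c)
  have hI := (hind.comp (hmeas (a + b)) (hmeas (a - b))).integral_fun_mul_eq_mul_integral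
    ((hmeas (a + b)).comp_aemeasurable hSD.fst.aemeasurable).aestronglyMeasurable
    ((hmeas (a - b)).comp_aemeasurable hSD.snd.aemeasurable).aestronglyMeasurable
  simp only [Function.comp_def] at hI
  rw [integral_const_mul, hI,
    ← integral_map (f := fun s => gaussianPDFReal 0 (2 * t) (s - (a + b))) hSD.fst.aemeasurable
      (hmeas _).aestronglyMeasurable,
    ← integral_map (f := fun s => gaussianPDFReal 0 (2 * t) (s - (a - b))) hSD.snd.aemeasurable
      (hmeas _).aestronglyMeasurable, hSlaw, hDlaw]
  have ht' : (0 : ℝ) < t := by exact_mod_cast pos_iff_ne_zero.2 ht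
  have pS : 0 < 2 + 2 * ρ := by linarith
  have pD : 0 < 2 - 2 * ρ := by linarith
  have t2 : 2 * t ≠ 0 := by simpa using ht
  rw [integral_gaussianPDFReal_sub (by simpa using pS) t2,
    integral_gaussianPDFReal_sub (by simpa using pD) t2]
  have b2 := gaussianPDFReal_le 0 ((2 - 2 * ρ).toNNReal + 2 * t) (a - b)
  have b1 : gaussianPDFReal 0 ((2 + 2 * ρ).toNNReal + 2 * t) (a + b) ≤
      (√(2 * π * (2 + 2 * ρ + 2 * t)))⁻¹ * exp (-(u ^ 2 / (1 + w + t))) := by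
    rw [gaussianPDFReal]
    push_cast
    rw [Real.coe_toNNReal _ pS.le]
    gcongr
    rw [neg_div, neg_le_neg_iff, div_le_div_iff₀ (by linarith) (by linarith)]
    have : 4 * u ^ 2 ≤ (a + b - 0) ^ 2 := by nlinarith
    nlinarith [sq_nonneg u, sq_nonneg (a + b - 0)]
  push_cast at b2
  rw [Real.coe_toNNReal _ pD.le] at b2
  have hE := Real.exp_pos (-(u ^ 2 / (1 + w + t)))
  calc _ ≤ 2 * (((√(2 * π * (2 + 2 * ρ + 2 * t)))⁻¹ * exp (-(u ^ 2 / (1 + w + t)))) *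
        (√(2 * π * (2 - 2 * ρ + 2 * t)))⁻¹) := by
        gcongr
        exact gaussianPDFReal_nonneg _ _ _
    _ = exp (-(u ^ 2 / (1 + w + t))) *
        (2 * (√((2 * π * (2 + 2 * ρ + 2 * t)) * (2 * π * (2 - 2 * ρ + 2 * t))))⁻¹) := by
        rw [Real.sqrt_mul (show (0 : ℝ) ≤ 2 * π * (2 + 2 * ρ + 2 * t) from
          mul_nonneg (by positivity) (by linarith)) (2 * π * (2 - 2 * ρ + 2 * t)), mul_inv]
        ring
    _ ≤ exp (-(u ^ 2 / (1 + w + t))) * (√(1 - w ^ 2))⁻¹ := by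
        have hw2 : 0 < 1 - w ^ 2 := by nlinarith [abs_nonneg ρ]
        have : √(4 * (1 - w ^ 2)) ≤
            √((2 * π * (2 + 2 * ρ + 2 * t)) * (2 * π * (2 - 2 * ρ + 2 * t))) := by
          apply Real.sqrt_le_sqrt
          have e1 : 1 - w ^ 2 ≤ (1 + ρ + t) * (1 - ρ + t) := by
            have : ρ ^ 2 ≤ w ^ 2 := sq_le_sq' hρw.1 hρw.2
            nlinarith
          have e2 : 1 ≤ π ^ 2 := by nlinarith [pi_gt_three]
          have e3 : (2 * π * (2 + 2 * ρ + 2 * t)) * (2 * π * (2 - 2 * ρ + 2 * t)) =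
            π ^ 2 * (16 * ((1 + ρ + t) * (1 - ρ + t))) := by ring
          rw [e3]
          nlinarith
        rw [Real.sqrt_mul (by norm_num), show √(4 : ℝ) = 2 by
          rw [show (4 : ℝ) = 2 ^ 2 by norm_num]; exact Real.sqrt_sq (by norm_num)] at this
        gcongr
        have hs : 0 < √(1 - w ^ 2) := Real.sqrt_pos.2 hw2
        rw [← div_eq_mul_inv, div_le_iff₀ (by linarith), ← div_eq_inv_mul, le_div_iff₀ hs]
        exact this
    _ = _ := (div_eq_mul_inv _ _).symm

end Gaussian

lemma hasDerivAt_cdf_gaussianReal {v : ℝ≥0} (hv : v ≠ 0) (x : ℝ) :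
    HasDerivAt (cdf (gaussianReal 0 v)) (gaussianPDFReal 0 v x) x := by
  have hint := integrable_gaussianPDFReal 0 v
  have h : ∀ y, (cdf (gaussianReal 0 v)) y =
      (∫ s in Set.Iic 0, gaussianPDFReal 0 v s) + ∫ s in (0 : ℝ)..y, gaussianPDFReal 0 v s := by
    intro y
    rw [cdf_eq_real, Measure.real, gaussianReal_apply_eq_integral _ hv,
      ENNReal.toReal_ofReal (setIntegral_nonneg measurableSet_Iic fun s _ =>
        gaussianPDFReal_nonneg _ _ _),
      ← intervalIntegral.integral_Iic_sub_Iic hint.integrableOn hint.integrableOn]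
    ring
  have h2 := (intervalIntegral.integral_hasDerivAt_right (hint.intervalIntegrable (a := 0) (b := x))
    ((continuous_gaussianPDFReal 0 v).stronglyMeasurableAtFilter _ _)
    (continuous_gaussianPDFReal 0 v).continuousAt).const_add
      (∫ s in Set.Iic 0, gaussianPDFReal 0 v s)
  exact h2.congr_of_eventuallyEq (Eventually.of_forall h)

lemma abs_mul_gaussianPDFReal_le {v : ℝ≥0} (hv : v ≠ 0) (y : ℝ) :
    |(y - 0) / v * gaussianPDFReal 0 v y| ≤ (1 + v) / v * (√(2 * π * v))⁻¹ := by
  have hv' : (0 : ℝ) < v := by exact_mod_cast pos_iff_ne_zero.2 hv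
  rw [abs_mul, abs_div, abs_of_pos hv', abs_of_nonneg (gaussianPDFReal_nonneg _ _ _),
    gaussianPDFReal, sub_zero]
  have h1 : |y| * exp (-y ^ 2 / (2 * v)) ≤ 1 + v := by
    have e : -y ^ 2 / (2 * (v : ℝ)) = -(y ^ 2 / (2 * v)) := by ring
    rw [e, Real.exp_neg, ← div_eq_mul_inv, div_le_iff₀ (Real.exp_pos _)]
    have h2 := Real.add_one_le_exp (y ^ 2 / (2 * v))
    have h3 : |y| ≤ (1 + v) * (y ^ 2 / (2 * v) + 1) := by
      have : (1 + (v : ℝ)) * (y ^ 2 / (2 * v) + 1) = y ^ 2 / (2 * v) + 1 + y ^ 2 / 2 + v := by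
        field_simp; ring
      rw [this]
      have : 0 ≤ y ^ 2 / (2 * (v : ℝ)) := by positivity
      nlinarith [sq_abs y, sq_nonneg (|y| - 1)]
    exact h3.trans (by gcongr)
  calc _ = (|y| * exp (-y ^ 2 / (2 * v))) / v * (√(2 * π * v))⁻¹ := by ring
    _ ≤ _ := by gcongr

section Gaussian
variable {Ω : Type*} [MeasurableSpace Ω] {P : Measure Ω} {ι : Type*} [Fintype ι]

lemma gaussian_comparison_cdf {V W : Ω → ι → ℝ}
    (hVW : HasGaussianLaw (fun ω => (V ω, W ω)) P)
    (hVm : Measurable V) (hWm : Measurable W)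
    (hV0 : ∀ i, ∫ ω, V ω i ∂P = 0) (hW0 : ∀ i, ∫ ω, W ω i ∂P = 0)
    (hV1 : ∀ i, Var[fun ω => V ω i; P] = 1) (hW1 : ∀ i, Var[fun ω => W ω i; P] = 1)
    (hcov : ∀ i j, cov[fun ω => V ω i, fun ω => W ω j; P] = 0)
    {w : ι → ι → ℝ} (hw1 : ∀ i j, i ≠ j → w i j < 1)
    (hVw : ∀ i j, i ≠ j → |cov[fun ω => V ω i, fun ω => V ω j; P]| ≤ w i j)
    (hWw : ∀ i j, i ≠ j → |cov[fun ω => W ω i, fun ω => W ω j; P]| ≤ w i j)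
    {u c : ι → ℝ} {u₀ : ℝ} (hu₀ : 0 ≤ u₀) (hu : ∀ i, u₀ ≤ u i)
    (hc0 : ∀ i, 0 ≤ c i) (hc1 : ∀ i, c i ≤ 1) {M : ℝ} (hM : 0 < M) :
    |∫ ω, ∏ k, (1 - c k * cdf (gaussianReal 0 1) (M * (V ω k - u k))) ∂P
      - ∫ ω, ∏ k, (1 - c k * cdf (gaussianReal 0 1) (M * (W ω k - u k))) ∂P| ≤
      ∑ i, ∑ j, |cov[fun ω => V ω i, fun ω => V ω j; P]
        - cov[fun ω => W ω i, fun ω => W ω j; P]| *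
          (exp (-(u₀ ^ 2 / (1 + w i j + (M ^ 2)⁻¹))) / √(1 - w i j ^ 2)) := by
  have hprob := hVW.isProbabilityMeasure
  set t : ℝ≥0 := .mk (M ^ 2)⁻¹ (inv_nonneg.mpr (sq_nonneg _)) with ht
  have htr : (t : ℝ) = (M ^ 2)⁻¹ := rfl
  have ht0 : t ≠ 0 := by
    rw [← NNReal.coe_ne_zero, htr]; positivity
  set h : ι → ℝ → ℝ := fun k x => 1 - c k * cdf (gaussianReal 0 1) (M * (x - u k)) with hh
  set h' : ι → ℝ → ℝ := fun k x => -(c k * gaussianPDFReal 0 t (x - u k)) with hh'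
  set h'' : ι → ℝ → ℝ := fun k x =>
    c k * ((x - u k - 0) / t * gaussianPDFReal 0 t (x - u k)) with hh''
  have d1 : ∀ k x, HasDerivAt (h k) (h' k x) x := by
    intro k x
    have := ((hasDerivAt_cdf_gaussianReal one_ne_zero (M * (x - u k))).comp x
      (((hasDerivAt_id' x).sub_const (u k)).const_mul M)).const_mul (c k)
    refine (this.const_sub 1).congr_deriv ?_
    rw [gaussianPDFReal_mul hM.ne', abs_of_pos (by positivity)]
    simp only [hh', mul_zero, mul_one, ht]
    field_simp
  have d2 : ∀ k x, HasDerivAt (h' k) (h'' k x) x := by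
    intro k x
    have := ((hasDerivAt_gaussianPDFReal 0 t (x - u k)).comp x
      ((hasDerivAt_id' x).sub_const (u k))).const_mul (c k)
    refine this.neg.congr_deriv ?_
    simp only [hh'']; ring
  have c1 : ∀ k, Continuous (h' k) := fun k =>
    continuous_iff_continuousAt.2 fun x => (d2 k x).continuousAt
  have c2 : ∀ k, Continuous (h'' k) := fun k => by
    have := continuous_gaussianPDFReal 0 t
    simp only [hh'']
    fun_prop
  have b0 : ∀ k x, |h k x| ≤ 1 := by
    intro k x
    have h1 := cdf_nonneg (gaussianReal 0 1) (M * (x - u k))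
    have h2 := cdf_le_one (gaussianReal 0 1) (M * (x - u k))
    have h3 := mul_le_mul (hc1 k) h2 h1 zero_le_one
    have h4 := mul_nonneg (hc0 k) h1
    simp only [hh]
    rw [abs_le]; constructor <;> linarith
  have b1 : ∀ k x, |h' k x| ≤ gaussianPDFReal 0 t (x - u k) := by
    intro k x
    simp only [hh']
    rw [abs_neg, abs_mul, abs_of_nonneg (hc0 k), abs_of_nonneg (gaussianPDFReal_nonneg _ _ _)]
    exact mul_le_of_le_one_left (gaussianPDFReal_nonneg _ _ _) (hc1 k)
  have b2 : ∀ k x, |h'' k x| ≤ (1 + t) / t * (√(2 * π * t))⁻¹ := by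
    intro k x
    simp only [hh'']
    rw [abs_mul, abs_of_nonneg (hc0 k)]
    exact (mul_le_of_le_one_left (abs_nonneg _) (hc1 k)).trans (abs_mul_gaussianPDFReal_le ht0 _)
  have b0' : ∀ k, ∃ C, ∀ x, |h k x| ≤ C := fun k => ⟨1, b0 k⟩
  have b1' : ∀ k, ∃ C, ∀ x, |h' k x| ≤ C := fun k =>
    ⟨_, fun x => (b1 k x).trans (gaussianPDFReal_le _ _ _)⟩
  have b2' : ∀ k, ∃ C, ∀ x, |h'' k x| ≤ C := fun k => ⟨_, b2 k⟩
  have upd : ∀ {p q : ι → ℝ → ℝ} {Q : (ℝ → ℝ) → Prop} (i : ι), (∀ k, Q (p k)) → (∀ k, Q (q k)) →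
      ∀ k, Q (Function.update p i (q i) k) := by
    intro p q Q i hp hq k
    by_cases hk : k = i
    · subst hk; simpa using hq k
    · simpa [Function.update_of_ne hk] using hp k
  have hF := hasBddPartials_prod d1 c1 b0' b1'
  have hD : ∀ i, HasBddPartials (fun z : ι → ℝ => ∏ k, Function.update h i (h' i) k (z k))
      (fun j z => ∏ k, Function.update (Function.update h i (h' i)) j
        (Function.update h' i (h'' i) j) k (z k)) := by
    intro i
    refine hasBddPartials_prod ?_ (upd (Q := Continuous) i c1 c2)
      (upd (Q := fun f => ∃ C, ∀ x, |f x| ≤ C) i b0' b1')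
      (upd (Q := fun f => ∃ C, ∀ x, |f x| ≤ C) i b1' b2')
    intro k x
    by_cases hk : k = i
    · subst hk; simpa using d2 k x
    · simpa [Function.update_of_ne hk] using d1 k x
  refine gaussian_comparison hVW hVm hWm hV0 hW0 hcov hF hD fun θ => ?_
  refine (Finset.abs_sum_le_sum_abs _ _).trans (Finset.sum_le_sum fun i _ => ?_)
  refine (Finset.abs_sum_le_sum_abs _ _).trans (Finset.sum_le_sum fun j _ => ?_)
  have hVg : HasGaussianLaw V P := hVW.fst
  have hWg : HasGaussianLaw W P := hVW.snd
  have hVi : ∀ i, HasGaussianLaw (fun ω => V ω i) P := fun i => hVg.eval i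
  have hWi : ∀ i, HasGaussianLaw (fun ω => W ω i) P := fun i => hWg.eval i
  rw [abs_mul]
  by_cases hij : i = j
  · subst hij
    rw [covariance_self (hVi i).aemeasurable, covariance_self (hWi i).aemeasurable, hV1, hW1]
    simp
  refine mul_le_mul_of_nonneg_left ?_ (abs_nonneg _)
  set Z : Ω → ι → ℝ := fun ω k => sin θ * V ω k + cos θ * W ω k with hZ
  have hpair : HasGaussianLaw (fun ω => (Z ω i, Z ω j)) P := by
    have := hVW.map_fun
      ((sin θ • (ContinuousLinearMap.proj i).comp (ContinuousLinearMap.fst ℝ (ι → ℝ) (ι → ℝ)) +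
        cos θ • (ContinuousLinearMap.proj i).comp
          (ContinuousLinearMap.snd ℝ (ι → ℝ) (ι → ℝ))).prod
       (sin θ • (ContinuousLinearMap.proj j).comp (ContinuousLinearMap.fst ℝ (ι → ℝ) (ι → ℝ)) +
        cos θ • (ContinuousLinearMap.proj j).comp
          (ContinuousLinearMap.snd ℝ (ι → ℝ) (ι → ℝ))))
    exact this
  have hZ0 : ∀ i, ∫ ω, Z ω i ∂P = 0 := by
    intro i
    simp only [hZ]
    rw [integral_add ((hVi i).integrable.const_mul _) ((hWi i).integrable.const_mul _),
      integral_const_mul, integral_const_mul, hV0, hW0]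
    simp
  have hZc : ∀ i j, cov[fun ω => Z ω i, fun ω => Z ω j; P] =
      sin θ ^ 2 * cov[fun ω => V ω i, fun ω => V ω j; P] +
        cos θ ^ 2 * cov[fun ω => W ω i, fun ω => W ω j; P] := by
    intro i j
    have a1 := (hVi i).memLp_two
    have a2 := (hVi j).memLp_two
    have a3 := (hWi i).memLp_two
    have a4 := (hWi j).memLp_two
    have hcovW : cov[fun ω => W ω i, fun ω => V ω j; P] = 0 := by
      rw [covariance_comm]; exact hcov j i
    simp only [hZ]
    rw [covariance_fun_add_left (a1.const_mul _) (a3.const_mul _)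
      (show MemLp (fun ω => sin θ * V ω j + cos θ * W ω j) 2 P from
        (a2.const_mul _).add (a4.const_mul _)),
      covariance_fun_add_right (a1.const_mul _) (a2.const_mul _) (a4.const_mul _),
      covariance_fun_add_right (a3.const_mul _) (a2.const_mul _) (a4.const_mul _)]
    simp only [covariance_const_mul_left, covariance_const_mul_right, hcov, hcovW]
    ring
  have hZg : ∀ i, AEMeasurable (fun ω => Z ω i) P := fun i =>
    ((hVi i).aemeasurable.const_mul _).add ((hWi i).aemeasurable.const_mul _)
  have hZ1 : ∀ i, Var[fun ω => Z ω i; P] = 1 := by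
    intro i
    rw [← covariance_self (hZg i), hZc, covariance_self (hVi i).aemeasurable,
      covariance_self (hWi i).aemeasurable, hV1, hW1]
    simp
  have hZw : |cov[fun ω => Z ω i, fun ω => Z ω j; P]| ≤ w i j := by
    rw [hZc]
    refine (abs_add_le _ _).trans ?_
    rw [abs_mul, abs_mul, abs_of_nonneg (sq_nonneg (sin θ)), abs_of_nonneg (sq_nonneg (cos θ))]
    refine (add_le_add (mul_le_mul_of_nonneg_left (hVw i j hij) (sq_nonneg (sin θ)))
      (mul_le_mul_of_nonneg_left (hWw i j hij) (sq_nonneg (cos θ)))).trans ?_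
    rw [← add_mul, sin_sq_add_cos_sq, one_mul]
  have hmain := integral_gaussianPDFReal_mul_le hpair (hZ0 i) (hZ0 j) (hZ1 i) (hZ1 j) hZw
    (hw1 i j hij) ht0 hu₀ (hu i) (hu j)
  rw [htr] at hmain
  refine le_trans ?_ hmain
  have hpd : ∀ a : ℝ, Measurable fun s => gaussianPDFReal 0 t (s - a) := fun a =>
    (measurable_gaussianPDFReal _ _).comp (measurable_id.sub_const a)
  refine (abs_integral_le_integral_abs).trans (integral_mono_of_nonneg
    (ae_of_all _ fun _ => abs_nonneg _) ?_ (ae_of_all _ fun ω => ?_))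
  · refine Integrable.of_bound (C := (√(2 * π * t))⁻¹ * (√(2 * π * t))⁻¹)
      (((hpd _).comp_aemeasurable (hZg i)).mul
        ((hpd _).comp_aemeasurable (hZg j))).aestronglyMeasurable
      (ae_of_all _ fun ω => ?_)
    rw [Real.norm_eq_abs, abs_of_nonneg (mul_nonneg (gaussianPDFReal_nonneg _ _ _)
      (gaussianPDFReal_nonneg _ _ _))]
    exact mul_le_mul (gaussianPDFReal_le _ _ _) (gaussianPDFReal_le _ _ _)
      (gaussianPDFReal_nonneg _ _ _) (by positivity)
  · change |∏ k, Function.update (Function.update h i (h' i)) j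
        (Function.update h' i (h'' i) j) k (Z ω k)| ≤ _
    rw [Finset.abs_prod, ← Finset.mul_prod_erase _ _ (Finset.mem_univ i),
      ← Finset.mul_prod_erase _ _ (Finset.mem_erase.2 ⟨Ne.symm hij, Finset.mem_univ j⟩),
      ← mul_assoc]
    refine (mul_le_of_le_one_right (by positivity) (Finset.prod_le_one (fun _ _ => abs_nonneg _)
      fun k hk => ?_)).trans ?_
    · simp only [Finset.mem_erase] at hk
      rw [Function.update_of_ne hk.1, Function.update_of_ne hk.2.1]
      exact b0 _ _
    · rw [Function.update_of_ne hij, Function.update_self, Function.update_self,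
        Function.update_of_ne (Ne.symm hij)]
      exact mul_le_mul (b1 _ _) (b1 _ _) (abs_nonneg _) (gaussianPDFReal_nonneg _ _ _)

/-- Normal comparison lemma for products of weighted exceedance indicators. -/
lemma gaussian_comparison_indicator {V W : Ω → ι → ℝ}
    (hVW : HasGaussianLaw (fun ω => (V ω, W ω)) P)
    (hVm : Measurable V) (hWm : Measurable W)
    (hV0 : ∀ i, ∫ ω, V ω i ∂P = 0) (hW0 : ∀ i, ∫ ω, W ω i ∂P = 0)
    (hV1 : ∀ i, Var[fun ω => V ω i; P] = 1) (hW1 : ∀ i, Var[fun ω => W ω i; P] = 1)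
    (hcov : ∀ i j, cov[fun ω => V ω i, fun ω => W ω j; P] = 0)
    {w : ι → ι → ℝ} (hw0 : ∀ i j, 0 ≤ w i j) (hw1 : ∀ i j, i ≠ j → w i j < 1)
    (hVw : ∀ i j, i ≠ j → |cov[fun ω => V ω i, fun ω => V ω j; P]| ≤ w i j)
    (hWw : ∀ i j, i ≠ j → |cov[fun ω => W ω i, fun ω => W ω j; P]| ≤ w i j)
    {u c : ι → ℝ} {u₀ : ℝ} (hu₀ : 0 ≤ u₀) (hu : ∀ i, u₀ ≤ u i)
    (hc0 : ∀ i, 0 ≤ c i) (hc1 : ∀ i, c i ≤ 1) :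
    |∫ ω, ∏ k, (1 - c k * if u k < V ω k then 1 else 0) ∂P
      - ∫ ω, ∏ k, (1 - c k * if u k < W ω k then 1 else 0) ∂P| ≤
      ∑ i, ∑ j, |cov[fun ω => V ω i, fun ω => V ω j; P]
        - cov[fun ω => W ω i, fun ω => W ω j; P]| *
          (exp (-(u₀ ^ 2 / (1 + w i j))) / √(1 - w i j ^ 2)) := by
  have hprob := hVW.isProbabilityMeasure
  have key : ∀ {V : Ω → ι → ℝ}, HasGaussianLaw V P → Measurable V →
      (∀ i, ∫ ω, V ω i ∂P = 0) → (∀ i, Var[fun ω => V ω i; P] = 1) →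
      Tendsto (fun m : ℕ => ∫ ω, ∏ k, (1 - c k * cdf (gaussianReal 0 1)
          (((m : ℝ) + 1) * (V ω k - u k))) ∂P) atTop
        (nhds (∫ ω, ∏ k, (1 - c k * if u k < V ω k then 1 else 0) ∂P)) := by
    intro V hV hVm hV0 hV1
    have hVim : ∀ i, Measurable fun ω => V ω i := fun i => (measurable_pi_apply i).comp hVm
    have hne : ∀ᵐ ω ∂P, ∀ k, V ω k ≠ u k := by
      rw [ae_all_iff]
      intro k
      have hlaw : P.map (fun ω => V ω k) = gaussianReal 0 1 := by
        rw [(hV.eval k).map_eq_gaussianReal, hV0, hV1]; simp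
      have : (P.map fun ω => V ω k) {u k} = 0 := by
        rw [hlaw]
        have := nullSingletonClass_gaussianReal (μ := 0) (v := 1) one_ne_zero
        exact measure_singleton _
      rw [Measure.map_apply (hVim k) (measurableSet_singleton _)] at this
      rw [ae_iff]
      simpa [Set.preimage] using this
    refine tendsto_integral_of_dominated_convergence (fun _ => 1) (fun m => ?_)
      (integrable_const _) (fun m => ae_of_all _ fun ω => ?_) ?_
    · refine (Finset.measurable_fun_prod _ fun k _ => ?_).aestronglyMeasurable
      exact (((monotone_cdf _).measurable.comp
        (((hVim k).sub_const _).const_mul _)).const_mul _).const_sub _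
    · rw [Real.norm_eq_abs, Finset.abs_prod]
      refine Finset.prod_le_one (fun _ _ => abs_nonneg _) fun k _ => ?_
      have h1 := cdf_nonneg (gaussianReal 0 1) (((m : ℝ) + 1) * (V ω k - u k))
      have h2 := cdf_le_one (gaussianReal 0 1) (((m : ℝ) + 1) * (V ω k - u k))
      have h3 := mul_le_mul (hc1 k) h2 h1 zero_le_one
      have h4 := mul_nonneg (hc0 k) h1
      rw [abs_le]; constructor <;> linarith
    · filter_upwards [hne] with ω hω
      refine tendsto_finsetProd _ fun k _ => ((Tendsto.const_mul _ ?_).const_sub _)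
      have hm : Tendsto (fun m : ℕ => (m : ℝ) + 1) atTop atTop :=
        tendsto_atTop_add_const_right _ _ tendsto_natCast_atTop_atTop
      rcases lt_or_gt_of_ne (hω k) with h | h
      · rw [if_neg (not_lt.2 h.le)]
        exact (tendsto_cdf_atBot _).comp (hm.atTop_mul_const_of_neg (sub_neg.2 h))
      · rw [if_pos h]
        exact (tendsto_cdf_atTop _).comp (hm.atTop_mul_const (sub_pos.2 h))
  have hl := ((key hVW.fst hVm hV0 hV1).sub (key hVW.snd hWm hW0 hW1)).abs
  have hm : Tendsto (fun m : ℕ => (((m : ℝ) + 1) ^ 2)⁻¹) atTop (nhds 0) := by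
    refine tendsto_inv_atTop_zero.comp ((tendsto_pow_atTop two_ne_zero).comp ?_)
    exact tendsto_atTop_add_const_right _ _ tendsto_natCast_atTop_atTop
  refine le_of_tendsto_of_tendsto' hl ?_ fun m => gaussian_comparison_cdf hVW hVm hWm hV0 hW0 hV1
    hW1 hcov hw1 hVw hWw hu₀ hu hc0 hc1 (M := (m : ℝ) + 1) (by positivity)
  refine tendsto_finsetSum _ fun i _ => tendsto_finsetSum _ fun j _ => Tendsto.const_mul _ ?_
  refine Tendsto.div_const ((Real.continuous_exp.tendsto _).comp (Tendsto.neg ?_)) _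
  refine Tendsto.div tendsto_const_nhds ?_ (by have := hw0 i j; positivity)
  simpa using hm.const_add (1 + w i j)

end Gaussian

section Transfer
variable {Ω Ω' : Type*} [MeasurableSpace Ω] [MeasurableSpace Ω'] {P : Measure Ω} {P' : Measure Ω'}
  {φ : Ω → Ω'}

lemma MeasureTheory.MeasurePreserving.integral_fun_comp (h : MeasurePreserving φ P P')
    {f : Ω' → ℝ} (hf : Measurable f) : ∫ ω, f (φ ω) ∂P = ∫ ω, f ω ∂P' := by
  rw [← h.map_eq, integral_map h.measurable.aemeasurable hf.aestronglyMeasurable]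

lemma MeasureTheory.MeasurePreserving.covariance_fun_comp (h : MeasurePreserving φ P P')
    {f k : Ω' → ℝ} (hf : Measurable f) (hk : Measurable k) :
    cov[fun ω => f (φ ω), fun ω => k (φ ω); P] = cov[f, k; P'] := by
  rw [← h.map_eq, covariance_map_fun hf.aestronglyMeasurable hk.aestronglyMeasurable
    h.measurable.aemeasurable]

end Transfer

section Gaussian
variable {Ω Ω' : Type*} [MeasurableSpace Ω] [MeasurableSpace Ω'] {P : Measure Ω} {P' : Measure Ω'}
  {ι : Type*} [Fintype ι]

lemma gaussian_comparison_indicator_prod {V : Ω → ι → ℝ} {W : Ω' → ι → ℝ}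
    (hV : HasGaussianLaw V P) (hW : HasGaussianLaw W P')
    (hVm : Measurable V) (hWm : Measurable W)
    (hV0 : ∀ i, ∫ ω, V ω i ∂P = 0) (hW0 : ∀ i, ∫ ω, W ω i ∂P' = 0)
    (hV1 : ∀ i, Var[fun ω => V ω i; P] = 1) (hW1 : ∀ i, Var[fun ω => W ω i; P'] = 1)
    {w : ι → ι → ℝ} (hw0 : ∀ i j, 0 ≤ w i j) (hw1 : ∀ i j, i ≠ j → w i j < 1)
    (hVw : ∀ i j, i ≠ j → |cov[fun ω => V ω i, fun ω => V ω j; P]| ≤ w i j)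
    (hWw : ∀ i j, i ≠ j → |cov[fun ω => W ω i, fun ω => W ω j; P']| ≤ w i j)
    {u c : ι → ℝ} {u₀ : ℝ} (hu₀ : 0 ≤ u₀) (hu : ∀ i, u₀ ≤ u i)
    (hc0 : ∀ i, 0 ≤ c i) (hc1 : ∀ i, c i ≤ 1) :
    |∫ ω, ∏ k, (1 - c k * if u k < V ω k then 1 else 0) ∂P
      - ∫ ω, ∏ k, (1 - c k * if u k < W ω k then 1 else 0) ∂P'| ≤
      ∑ i, ∑ j, |cov[fun ω => V ω i, fun ω => V ω j; P]
        - cov[fun ω => W ω i, fun ω => W ω j; P']| *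
          (exp (-(u₀ ^ 2 / (1 + w i j))) / √(1 - w i j ^ 2)) := by
  have := hV.isProbabilityMeasure
  have := hW.isProbabilityMeasure
  have hVim : ∀ i, Measurable fun ω => V ω i := fun i => (measurable_pi_apply i).comp hVm
  have hWim : ∀ i, Measurable fun ω => W ω i := fun i => (measurable_pi_apply i).comp hWm
  have hf : MeasurePreserving Prod.fst (P.prod P') P := measurePreserving_fst
  have hs : MeasurePreserving Prod.snd (P.prod P') P' := measurePreserving_snd
  have hVW : HasGaussianLaw (fun ω : Ω × Ω' => (V ω.1, W ω.2)) (P.prod P') := by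
    refine ⟨?_⟩
    have e : (P.prod P').map (fun ω : Ω × Ω' => (V ω.1, W ω.2)) = (P.map V).prod (P'.map W) :=
      (Measure.map_prod_map _ _ hVm hWm).symm
    rw [e]
    have := hV.isGaussian_map
    have := hW.isGaussian_map
    infer_instance
  have hind : IndepFun (Prod.fst : Ω × Ω' → Ω) Prod.snd (P.prod P') := by
    rw [indepFun_iff_map_prod_eq_prod_map_map measurable_fst.aemeasurable
      measurable_snd.aemeasurable, hf.map_eq, hs.map_eq]
    exact Measure.map_id
  have mk : Measurable fun z : ι → ℝ =>
      ∏ k, (1 - c k * if u k < z k then (1 : ℝ) else 0) := by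
    refine Finset.measurable_fun_prod _ fun k _ =>
      Measurable.const_sub (Measurable.const_mul ?_ _) _
    exact Measurable.ite (measurableSet_lt measurable_const (measurable_pi_apply k))
      measurable_const measurable_const
  have hres := gaussian_comparison_indicator hVW (hVm.comp measurable_fst)
    (hWm.comp measurable_snd)
    (fun i => (hf.integral_fun_comp (hVim i)).trans (hV0 i))
    (fun i => (hs.integral_fun_comp (hWim i)).trans (hW0 i))
    (fun i => (hf.variance_fun_comp (hVim i).aemeasurable).trans (hV1 i))
    (fun i => (hs.variance_fun_comp (hWim i).aemeasurable).trans (hW1 i))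
    (fun i j => (hind.comp (hVim i) (hWim j)).covariance_eq_zero
      ((hVW.fst.eval i).memLp_two) ((hVW.snd.eval j).memLp_two))
    hw0 hw1 (fun i j hij => (hf.covariance_fun_comp (hVim i) (hVim j)).symm ▸ hVw i j hij)
    (fun i j hij => (hs.covariance_fun_comp (hWim i) (hWim j)).symm ▸ hWw i j hij)
    hu₀ hu hc0 hc1
  simp only [hf.covariance_fun_comp (hVim _) (hVim _), hs.covariance_fun_comp (hWim _) (hWim _)]
    at hres
  rwa [hf.integral_fun_comp (f := fun ω => ∏ k, (1 - c k * if u k < V ω k then (1 : ℝ) else 0))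
    (mk.comp hVm), hs.integral_fun_comp
    (f := fun ω => ∏ k, (1 - c k * if u k < W ω k then (1 : ℝ) else 0))
    (mk.comp hWm)] at hres

/-- Upper tail of the standard normal law. -/
noncomputable def gaussianTail (x : ℝ) : ℝ := (gaussianReal 0 1).real (Set.Ioi x)

lemma hasGaussianLaw_id_pi : HasGaussianLaw (fun ξ : ι → ℝ => ξ)
    (Measure.pi fun _ : ι => gaussianReal 0 1) := by
  refine iIndepFun.hasGaussianLaw (X := fun i (ξ : ι → ℝ) => ξ i) (fun i => ?_) ?_
  · refine ⟨?_⟩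
    rw [(measurePreserving_eval (fun _ : ι => gaussianReal 0 1) i).map_eq]
    infer_instance
  · exact iIndepFun_pi (X := fun _ x => x) fun _ => measurable_id.aemeasurable

/-- Comparison with the equicorrelated Gaussian vector of correlation `ρ`. -/
lemma gaussian_comparison_equicorrelated {V : Ω → ι → ℝ}
    (hV : HasGaussianLaw V P) (hVm : Measurable V)
    (hV0 : ∀ i, ∫ ω, V ω i ∂P = 0) (hV1 : ∀ i, Var[fun ω => V ω i; P] = 1)
    {ρ : ℝ} (hρ0 : 0 ≤ ρ) (hρ1 : ρ < 1)
    {w : ι → ι → ℝ} (hw1 : ∀ i j, i ≠ j → w i j < 1)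
    (hVw : ∀ i j, i ≠ j → |cov[fun ω => V ω i, fun ω => V ω j; P]| ≤ w i j)
    (hρw : ∀ i j, ρ ≤ w i j)
    {u c : ι → ℝ} {u₀ : ℝ} (hu₀ : 0 ≤ u₀) (hu : ∀ i, u₀ ≤ u i)
    (hc0 : ∀ i, 0 ≤ c i) (hc1 : ∀ i, c i ≤ 1) :
    |∫ ω, ∏ k, (1 - c k * if u k < V ω k then 1 else 0) ∂P
      - ∫ z, ∏ k, (1 - c k * gaussianTail ((u k - √ρ * z) / √(1 - ρ))) ∂(gaussianReal 0 1)| ≤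
      ∑ i, ∑ j, |cov[fun ω => V ω i, fun ω => V ω j; P] - if i = j then 1 else ρ| *
          (exp (-(u₀ ^ 2 / (1 + w i j))) / √(1 - w i j ^ 2)) := by
  set μ : Measure (ι → ℝ) := Measure.pi fun _ : ι => gaussianReal 0 1 with hμ
  set ν : Measure ((ι → ℝ) × ℝ) := μ.prod (gaussianReal 0 1) with hν
  set s := √(1 - ρ) with hs
  set r := √ρ with hr
  have hs0 : 0 < s := Real.sqrt_pos.2 (by linarith)
  have hs2 : s ^ 2 = 1 - ρ := Real.sq_sqrt (by linarith)
  have hr2 : r ^ 2 = ρ := Real.sq_sqrt hρ0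
  set W : (ι → ℝ) × ℝ → ι → ℝ := fun ω i => s * ω.1 i + r * ω.2 with hW
  have hfst : MeasurePreserving Prod.fst ν μ := measurePreserving_fst
  have hsnd : MeasurePreserving Prod.snd ν (gaussianReal 0 1) := measurePreserving_snd
  have hev : ∀ i, MeasurePreserving (fun ω : (ι → ℝ) × ℝ => ω.1 i) ν (gaussianReal 0 1) :=
    fun i => (measurePreserving_eval (fun _ : ι => gaussianReal 0 1) i).comp hfst
  have hid : HasGaussianLaw (fun ω : (ι → ℝ) × ℝ => ω) ν := by
    refine ⟨?_⟩
    have h1 : IsGaussian μ := by simpa using (hasGaussianLaw_id_pi (ι := ι)).isGaussian_map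
    have : IsGaussian ν := by rw [hν]; infer_instance
    rw [Measure.map_id']
    exact this
  have hWg : HasGaussianLaw W ν := by
    have := hid.map_fun (s • ContinuousLinearMap.fst ℝ (ι → ℝ) ℝ +
      r • (ContinuousLinearMap.pi fun _ : ι => ContinuousLinearMap.snd ℝ (ι → ℝ) ℝ))
    exact this
  have hWm : Measurable W := by
    rw [measurable_pi_iff]; intro i; simp only [hW]; fun_prop
  have hind : IndepFun (Prod.fst : (ι → ℝ) × ℝ → (ι → ℝ)) Prod.snd ν := by
    rw [indepFun_iff_map_prod_eq_prod_map_map measurable_fst.aemeasurable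
      measurable_snd.aemeasurable, hfst.map_eq, hsnd.map_eq]
    exact Measure.map_id
  have m1 : ∀ i, MemLp (fun ω : (ι → ℝ) × ℝ => ω.1 i) 2 ν := fun i =>
    (hid.fst.eval i).memLp_two
  have m2 : MemLp (fun ω : (ι → ℝ) × ℝ => ω.2) 2 ν := hid.snd.memLp_two
  have z1 : ∀ i, ∫ ω : (ι → ℝ) × ℝ, ω.1 i ∂ν = 0 := fun i => by
    rw [(hev i).integral_fun_comp (f := fun x => x) measurable_id]; simp
  have z2 : ∫ ω : (ι → ℝ) × ℝ, ω.2 ∂ν = 0 := by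
    rw [hsnd.integral_fun_comp (f := fun x => x) measurable_id]; simp
  have cross : ∀ i, cov[fun ω : (ι → ℝ) × ℝ => ω.1 i, fun ω => ω.2; ν] = 0 := fun i =>
    (hind.comp (measurable_pi_apply i) measurable_id).covariance_eq_zero (m1 i) m2
  have cross' : ∀ i, cov[fun ω : (ι → ℝ) × ℝ => ω.2, fun ω => ω.1 i; ν] = 0 := fun i => by
    rw [covariance_comm]; exact cross i
  have c22 : cov[fun ω : (ι → ℝ) × ℝ => ω.2, fun ω => ω.2; ν] = 1 := by
    rw [covariance_self measurable_snd.aemeasurable,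
      hsnd.variance_fun_comp (f := fun x => x) measurable_id.aemeasurable]
    exact variance_id_gaussianReal
  have c11 : ∀ i j, cov[fun ω : (ι → ℝ) × ℝ => ω.1 i, fun ω => ω.1 j; ν] =
      if i = j then 1 else 0 := by
    intro i j
    split_ifs with hij
    · subst hij
      rw [covariance_self (hev i).measurable.aemeasurable,
        (hev i).variance_fun_comp (f := fun x => x) measurable_id.aemeasurable]
      exact variance_id_gaussianReal
    · rw [hfst.covariance_fun_comp (measurable_pi_apply i) (measurable_pi_apply j)]
      have hi := (iIndepFun_pi (μ := fun _ : ι => gaussianReal 0 1) (X := fun _ x => x)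
        fun _ => measurable_id.aemeasurable).indepFun hij
      exact hi.covariance_eq_zero (hasGaussianLaw_id_pi.eval i).memLp_two
        (hasGaussianLaw_id_pi.eval j).memLp_two
  have hWc : ∀ i j, cov[fun ω => W ω i, fun ω => W ω j; ν] = if i = j then 1 else ρ := by
    intro i j
    simp only [hW]
    rw [covariance_fun_add_left ((m1 i).const_mul _) (m2.const_mul _)
      (show MemLp (fun ω : (ι → ℝ) × ℝ => s * ω.1 j + r * ω.2) 2 ν from
        ((m1 j).const_mul _).add (m2.const_mul _)),
      covariance_fun_add_right ((m1 i).const_mul _) ((m1 j).const_mul _) (m2.const_mul _),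
      covariance_fun_add_right (m2.const_mul _) ((m1 j).const_mul _) (m2.const_mul _)]
    simp only [covariance_const_mul_left, covariance_const_mul_right, cross, cross', c11, c22]
    split_ifs <;> nlinarith
  have hW0 : ∀ i, ∫ ω, W ω i ∂ν = 0 := by
    intro i
    simp only [hW]
    rw [integral_add (((m1 i).integrable (by norm_num)).const_mul _)
      ((m2.integrable (by norm_num)).const_mul _), integral_const_mul, integral_const_mul, z1, z2]
    simp
  have hW1 : ∀ i, Var[fun ω => W ω i; ν] = 1 := by
    intro i
    rw [← covariance_self (hWg.eval i).aemeasurable, hWc, if_pos rfl]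
  have hres := gaussian_comparison_indicator_prod hV hWg hVm hWm hV0 hW0 hV1 hW1
    (w := w) (fun i j => hρ0.trans (hρw i j)) hw1 hVw (fun i j hij => by
      rw [hWc, if_neg hij, abs_of_nonneg hρ0]; exact hρw i j) hu₀ hu hc0 hc1
  simp only [hWc] at hres
  have hint : ∫ ω, ∏ k, (1 - c k * if u k < W ω k then 1 else 0) ∂ν =
      ∫ z, ∏ k, (1 - c k * gaussianTail ((u k - r * z) / s)) ∂(gaussianReal 0 1) := by
    rw [hν, integral_prod_symm]
    · refine integral_congr_ae (ae_of_all _ fun z => ?_)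
      simp only [hW]
      rw [integral_fintype_prod_eq_prod
        (f := fun k ξ => 1 - c k * if u k < s * ξ + r * z then (1 : ℝ) else 0)]
      refine Finset.prod_congr rfl fun k _ => ?_
      have hset : ∀ ξ : ℝ, (if u k < s * ξ + r * z then (1 : ℝ) else 0) =
          Set.indicator (Set.Ioi ((u k - r * z) / s)) (fun _ => 1) ξ := by
        intro ξ
        simp only [Set.indicator, Set.mem_Ioi, div_lt_iff₀ hs0, sub_lt_iff_lt_add, mul_comm ξ]
      simp only [hset]
      rw [integral_sub (integrable_const _) ((((integrable_const (1 : ℝ)).indicator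
        measurableSet_Ioi)).const_mul _), integral_const_mul, integral_indicator_const
        _ measurableSet_Ioi]
      simp [gaussianTail]
    · refine Integrable.of_bound (C := 1) ?_ (ae_of_all _ fun ω => ?_)
      · refine (Finset.measurable_fun_prod _ fun k _ =>
          Measurable.const_sub (Measurable.const_mul ?_ _) _).aestronglyMeasurable
        exact Measurable.ite (measurableSet_lt measurable_const ((measurable_pi_apply k).comp hWm))
          measurable_const measurable_const
      · rw [Real.norm_eq_abs, Finset.abs_prod]
        refine Finset.prod_le_one (fun _ _ => abs_nonneg _) fun k _ => ?_
        have := hc0 k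
        have := hc1 k
        split_ifs <;> rw [abs_le] <;> constructor <;> linarith
  rwa [hint] at hres

end Gaussian

lemma tendsto_log_natCast : Tendsto (fun n : ℕ => log n) atTop atTop :=
  tendsto_log_atTop.comp tendsto_natCast_atTop_atTop

lemma tendsto_sqrt_two_mul_log : Tendsto (fun n : ℕ => √(2 * log n)) atTop atTop :=
  tendsto_sqrt_atTop.comp (tendsto_log_natCast.const_mul_atTop two_pos)

lemma log_natCast_pos {n : ℕ} (hn : 2 ≤ n) : 0 < log (n : ℝ) :=
  Real.log_pos (by exact_mod_cast hn)

/-- The identity behind the choice of the normalizing constants. -/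
lemma exp_neg_sq_un {n : ℕ} (hn : 2 ≤ n) (c : ℝ) :
    exp (-un n c ^ 2 / 2) = √(2 * π) * √(2 * log n) / n *
      exp (-c - ((c - (log (log n) + log (4 * π)) / 2) / √(2 * log n)) ^ 2 / 2) := by
  have hL := log_natCast_pos hn
  have hn0 : (0 : ℝ) < n := by positivity
  set L := log (n : ℝ) with hLdef
  set a := √(2 * L) with ha
  set δ := log L + log (4 * π) with hδ
  have ha0 : 0 < a := Real.sqrt_pos.2 (by positivity)
  have ha2 : a ^ 2 = 2 * L := Real.sq_sqrt (by positivity)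
  have e1 : -un n c ^ 2 / 2 = -L + δ / 2 + (-c - ((c - δ / 2) / a) ^ 2 / 2) := by
    have : un n c = a + (c - δ / 2) / a := by
      simp only [un, ← hLdef, ← ha, ← hδ]; field_simp; ring
    rw [this]
    have : (a + (c - δ / 2) / a) ^ 2 = a ^ 2 + 2 * (c - δ / 2) + ((c - δ / 2) / a) ^ 2 := by
      field_simp; ring
    rw [this, ha2]; ring
  rw [e1, Real.exp_add, Real.exp_add, Real.exp_neg, hLdef, Real.exp_log hn0]
  have e2 : exp (δ / 2) = √(2 * π) * a := by
    rw [hδ, ← Real.log_mul hL.ne' (by positivity), Real.exp_half, Real.exp_log (by positivity), ha,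
      ← Real.sqrt_mul (by positivity)]
    congr 1; ring
  rw [e2]; ring

lemma tendsto_log_log_div_sqrt (κ : ℝ) :
    Tendsto (fun n : ℕ => (log (log n) + κ) / √(2 * log n)) atTop (nhds 0) := by
  have h1 : Tendsto (fun y : ℝ => log y / y ^ (1 / 2 : ℝ)) atTop (nhds 0) :=
    (isLittleO_log_rpow_atTop (by norm_num)).tendsto_div_nhds_zero
  have h2 : Tendsto (fun n : ℕ => log (log n) / √(log n)) atTop (nhds 0) := by
    refine (h1.comp tendsto_log_natCast).congr fun n => ?_
    simp [Real.sqrt_eq_rpow]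
  have h3 : Tendsto (fun n : ℕ => κ / √(2 * log n)) atTop (nhds 0) :=
    tendsto_sqrt_two_mul_log.const_div_atTop κ
  have := (h2.mul_const (√2)⁻¹).add h3
  simp only [zero_mul, add_zero] at this
  refine this.congr fun n => ?_
  rw [add_div, Real.sqrt_mul (by norm_num : (0 : ℝ) ≤ 2)]
  congr 1
  rw [div_mul_eq_div_div_swap, div_eq_mul_inv _ √2]

lemma gaussianTail_eq_integral (v : ℝ) {a : ℝ} (ha : 0 < a) :
    gaussianTail v = (√(2 * π))⁻¹ * exp (-v ^ 2 / 2) / a *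
      ∫ s in Set.Ioi 0, exp (-(v / a) * s - (s / a) ^ 2 / 2) := by
  rw [gaussianTail, Measure.real, gaussianReal_apply_eq_integral _ one_ne_zero,
    ENNReal.toReal_ofReal (setIntegral_nonneg measurableSet_Ioi fun s _ =>
        gaussianPDFReal_nonneg _ _ _)]
  have h1 := integral_comp_mul_left_Ioi (fun y => gaussianPDFReal 0 1 (y + v)) 0 (inv_pos.2 ha)
  have h2 := (measurePreserving_add_right volume v).setIntegral_preimage_emb
    (measurableEmbedding_addRight v) (gaussianPDFReal 0 1) (Set.Ioi v)
  simp only [Set.preimage_add_const_Ioi, sub_self, mul_zero, inv_inv, smul_eq_mul] at h1 h2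
  rw [h2] at h1
  rw [eq_comm, ← integral_const_mul, ← mul_right_inj' ha.ne', ← h1, ← integral_const_mul]
  refine setIntegral_congr_fun measurableSet_Ioi fun s _ => ?_
  simp only [gaussianPDFReal, NNReal.coe_one, mul_one, sub_zero]
  have : exp (-(a⁻¹ * s + v) ^ 2 / 2) =
      exp (-v ^ 2 / 2) * exp (-(v / a) * s - (s / a) ^ 2 / 2) := by
    rw [← Real.exp_add]; congr 1; field_simp; ring
  rw [this]
  field_simp

lemma tendsto_un_div {c : ℕ → ℝ} {c₀ : ℝ} (hc : Tendsto c atTop (nhds c₀)) :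
    Tendsto (fun n => un n (c n) / √(2 * log n)) atTop (nhds 1) := by
  have ha := tendsto_sqrt_two_mul_log
  have h1 : Tendsto (fun n => c n / √(2 * log n) / √(2 * log n)) atTop (nhds 0) :=
    (hc.div_atTop ha).div_atTop ha
  have h2 : Tendsto (fun n : ℕ => (log (log n) + log (4 * π)) / √(2 * log n) / (2 * √(2 * log n)))
      atTop (nhds 0) := (tendsto_log_log_div_sqrt _).div_atTop (ha.const_mul_atTop two_pos)
  have := (h1.add_const 1).sub h2
  simp only [zero_add, sub_zero] at this
  refine this.congr' ?_
  filter_upwards [ha.eventually_gt_atTop 0] with n hn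
  rw [un]; field_simp; ring

lemma tendsto_natCast_mul_gaussianTail {c : ℕ → ℝ} {c₀ : ℝ} (hc : Tendsto c atTop (nhds c₀)) :
    Tendsto (fun n : ℕ => n * gaussianTail (un n (c n))) atTop (nhds (exp (-c₀))) := by
  have ha := tendsto_sqrt_two_mul_log
  have hI : Tendsto (fun n : ℕ => ∫ s in Set.Ioi (0 : ℝ),
      exp (-(un n (c n) / √(2 * log n)) * s - (s / √(2 * log n)) ^ 2 / 2)) atTop
      (nhds (∫ s in Set.Ioi (0 : ℝ), exp (-s))) := by
    refine tendsto_integral_filter_of_dominated_convergence (fun s => exp (-(1 / 2) * s))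
      (Eventually.of_forall fun n => (by fun_prop : Continuous _).aestronglyMeasurable) ?_
      (exp_neg_integrableOn_Ioi 0 (by norm_num)) (ae_of_all _ fun s => ?_)
    · filter_upwards [(tendsto_un_div hc).eventually (lt_mem_nhds (by norm_num : (1 / 2 : ℝ) < 1))]
        with n hn
      refine (ae_restrict_iff' measurableSet_Ioi).2 (ae_of_all _ fun s hs => ?_)
      rw [Real.norm_eq_abs, Real.abs_exp, Real.exp_le_exp]
      have : 0 < s := hs
      nlinarith [sq_nonneg (s / √(2 * log n))]
    · refine (Real.continuous_exp.tendsto _).comp ?_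
      have h1 := ((tendsto_un_div hc).neg.mul_const s)
      have h2 := ((ha.const_div_atTop s).pow 2).div_const 2
      simpa using h1.sub h2
  rw [integral_exp_neg_Ioi_zero] at hI
  have hδ : Tendsto (fun n => exp (-c n - ((c n - (log (log n) + log (4 * π)) / 2)
      / √(2 * log n)) ^ 2 / 2)) atTop (nhds (exp (-c₀))) := by
    refine (Real.continuous_exp.tendsto _).comp ?_
    have h1 := ((hc.div_atTop ha).sub ((tendsto_log_log_div_sqrt (log (4 * π))).div_const 2))
    have h2 := hc.neg.sub ((h1.pow 2).div_const 2)
    simp only [zero_div, sub_zero, ne_eq, OfNat.ofNat_ne_zero, not_false_eq_true, zero_pow] at h2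
    refine h2.congr fun n => ?_
    congr 3; ring
  have := hδ.mul hI
  rw [mul_one] at this
  refine this.congr' ?_
  filter_upwards [eventually_ge_atTop 2] with n hn
  have hL := log_natCast_pos hn
  have ha0 : 0 < √(2 * log n) := Real.sqrt_pos.2 (by positivity)
  have hn0 : (0 : ℝ) < n := by positivity
  rw [gaussianTail_eq_integral _ ha0, exp_neg_sq_un hn]
  field_simp

lemma tendsto_natCast_mul_gaussianTail_mixture {γ : ℝ} (hγ : 0 ≤ γ) (x z : ℝ) :
    Tendsto (fun n : ℕ => n * gaussianTail ((un n x - √(γ / log n) * z) / √(1 - γ / log n)))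
      atTop (nhds (g γ x z)) := by
  set s : ℕ → ℝ := fun n => √(1 - γ / log n) with hs
  have hρ : Tendsto (fun n : ℕ => γ / log n) atTop (nhds 0) :=
    tendsto_log_natCast.const_div_atTop γ
  have hs1 : Tendsto s atTop (nhds 1) := by
    have := (hρ.const_sub 1).sqrt
    simpa using this
  set c : ℕ → ℝ := fun n => (x - √(2 * γ) * z) / s n +
    (2 * γ - γ / 2 * ((log (log n) + log (4 * π)) / √(2 * log n) * (2 / √(2 * log n))))
      / (s n * (1 + s n)) with hc
  have hlim : Tendsto c atTop (nhds (x - √(2 * γ) * z + γ)) := by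
    have h1 := (tendsto_log_log_div_sqrt (log (4 * π))).mul
      (tendsto_sqrt_two_mul_log.const_div_atTop 2)
    have h2 := ((h1.const_mul (γ / 2)).const_sub (2 * γ)).div (hs1.mul (hs1.const_add 1))
      (by norm_num)
    have h3 := ((tendsto_const_nhds (x := x - √(2 * γ) * z)).div hs1 one_ne_zero).add h2
    have e : (x - √(2 * γ) * z) / 1 + (2 * γ - γ / 2 * (0 * 0)) / (1 * (1 + 1)) =
      x - √(2 * γ) * z + γ := by ring
    rw [e] at h3
    exact h3
  have := tendsto_natCast_mul_gaussianTail hlim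
  have e : exp (-(x - √(2 * γ) * z + γ)) = g γ x z := by rw [g]; congr 1; ring
  rw [e] at this
  refine this.congr' ?_
  filter_upwards [eventually_ge_atTop 2, hs1.eventually (lt_mem_nhds zero_lt_one)] with n hn hsn
  congr 2
  have hL := log_natCast_pos hn
  have ha0 : 0 < √(2 * log n) := Real.sqrt_pos.2 (by positivity)
  have ha2 : √(2 * log n) ^ 2 = 2 * log n := Real.sq_sqrt (by positivity)
  have hs2 : s n ^ 2 = 1 - γ / log n := by
    refine Real.sq_sqrt ?_
    by_contra hneg
    rw [hs] at hsn
    simp only [Real.sqrt_eq_zero_of_nonpos (not_le.1 hneg).le, lt_irrefl] at hsn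
  have hγL : γ = (1 - s n ^ 2) * (√(2 * log n) ^ 2 / 2) := by
    rw [hs2, ha2]; field_simp; ring
  have hr : √(γ / log n) = √(2 * γ) / √(2 * log n) := by
    rw [← Real.sqrt_div (by positivity)]; congr 1; field_simp
  change un n (c n) = (un n x - √(γ / log n) * z) / s n
  rw [hr]
  simp only [un, hc]
  generalize log (log n) + log (4 * π) = δ at *
  generalize √(2 * log n) = a at *
  generalize √(2 * γ) = q at *
  generalize s n = t at *
  have ht : 1 + t ≠ 0 := by positivity
  rw [hγL]
  field_simp
  ring

lemma tendsto_zero_of_tendsto_mul_log {r : ℕ → ℝ} {γ : ℝ}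
    (hr : Tendsto (fun n : ℕ => r n * log n) atTop (nhds γ)) : Tendsto r atTop (nhds 0) := by
  refine (hr.div_atTop tendsto_log_natCast).congr' ?_
  filter_upwards [eventually_ge_atTop 2] with n hn
  have := log_natCast_pos hn
  field_simp

lemma exists_abs_le_of_tendsto_zero {r : ℕ → ℝ} (hr : Tendsto r atTop (nhds 0))
    (h1 : ∀ k, 1 ≤ k → |r k| < 1) : ∃ σ : ℝ, 0 < σ ∧ σ < 1 ∧ ∀ k, 1 ≤ k → |r k| ≤ σ := by
  have hev := (hr.abs.eventually (gt_mem_nhds (by norm_num : |(0 : ℝ)| < 1 / 2)))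
  obtain ⟨N, hN⟩ := eventually_atTop.1 hev
  have hne : (insert (1 / 2 : ℝ) ((Finset.Ico 1 N).image fun k => |r k|)).Nonempty :=
    Finset.insert_nonempty _ _
  refine ⟨_, (half_pos one_pos).trans_le (Finset.le_max' _ _ (Finset.mem_insert_self _ _)),
    (Finset.max'_lt_iff _ hne).2 ?_, fun k hk => ?_⟩
  · simp only [Finset.mem_insert, Finset.mem_image, Finset.mem_Ico]
    rintro y (rfl | ⟨k, hk, rfl⟩)
    · norm_num
    · exact h1 k hk.1
  · rcases lt_or_ge k N with h | h
    · exact Finset.le_max' _ _ (Finset.mem_insert_of_mem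
        (Finset.mem_image_of_mem (fun k => |r k|) (Finset.mem_Ico.2 ⟨hk, h⟩)))
    · exact (hN k h).le.trans (Finset.le_max' _ _ (Finset.mem_insert_self _ _))

lemma sum_log_sub_log_le (n : ℕ) : ∑ k ∈ Finset.Ico 1 n, (log n - log k) ≤ n := by
  induction n with
  | zero => simp
  | succ n ih =>
    rcases Nat.eq_zero_or_pos n with rfl | hn
    · simp
    have hn' : (0 : ℝ) < n := by exact_mod_cast hn
    have h : log ((n + 1 : ℕ) : ℝ) - log n ≤ 1 / n := by
      rw [← Real.log_div (by positivity) (by positivity)]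
      refine (Real.log_le_sub_one_of_pos (by positivity)).trans (le_of_eq ?_)
      push_cast; field_simp; ring
    have e : ∑ k ∈ Finset.Ico 1 (n + 1), (log ((n + 1 : ℕ) : ℝ) - log k) =
        ∑ k ∈ Finset.Ico 1 n, (log n - log k) + n * (log ((n + 1 : ℕ) : ℝ) - log n) := by
      rw [Finset.sum_Ico_succ_top hn]
      simp only [Finset.sum_sub_distrib, Finset.sum_const, Nat.card_Ico, nsmul_eq_mul]
      rw [Nat.cast_sub hn]; push_cast; ring
    rw [e]
    have h2 := mul_le_mul_of_nonneg_left h hn'.le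
    rw [mul_one_div_cancel hn'.ne'] at h2
    push_cast at *
    linarith

lemma card_filter_log_le {n : ℕ} {t : ℝ} :
    ((((Finset.Ico 1 n).filter fun k : ℕ => log k ≤ t).card : ℕ) : ℝ) ≤ exp t := by
  have : (Finset.Ico 1 n).filter (fun k : ℕ => log k ≤ t) ⊆ Finset.Ioc 0 ⌊exp t⌋₊ := by
    intro k hk
    rw [Finset.mem_filter, Finset.mem_Ico] at hk
    have hk0 : (0 : ℝ) < k := by exact_mod_cast hk.1.1
    exact Finset.mem_Ioc.2 ⟨hk.1.1, Nat.le_floor ((Real.log_le_iff_le_exp hk0).1 hk.2)⟩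
  have h := Finset.card_le_card this
  rw [Nat.card_Ioc, Nat.sub_zero] at h
  exact (Nat.cast_le.2 h).trans (Nat.floor_le (Real.exp_pos t).le)

lemma exp_neg_sq_un_le {n : ℕ} (hn : 2 ≤ n) (c : ℝ) :
    exp (-un n c ^ 2 / 2) ≤ √(2 * π) * exp (-c) * √(2 * log n) / n := by
  rw [exp_neg_sq_un hn]
  have : exp (-c - ((c - (log (log n) + log (4 * π)) / 2) / √(2 * log n)) ^ 2 / 2) ≤ exp (-c) :=
    Real.exp_le_exp.2 (by
      have := sq_nonneg ((c - (log (log n) + log (4 * π)) / 2) / √(2 * log n)); linarith)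
  calc _ ≤ √(2 * π) * √(2 * log n) / n * exp (-c) := by gcongr
    _ = _ := by ring

lemma tendsto_rpow_mul_log_rpow_div {θ α K : ℝ} (hK : 0 ≤ K)
    (hθ : 1 + α < θ) :
    Tendsto (fun n : ℕ => (n : ℝ) * exp (α * log n) * (K * √(2 * log n) / n) ^ θ)
      atTop (nhds 0) := by
  have h := ((isLittleO_log_rpow_rpow_atTop (θ / 2) (sub_pos.2 hθ)).tendsto_div_nhds_zero.comp
    tendsto_natCast_atTop_atTop).const_mul (K ^ θ * 2 ^ (θ / 2))
  rw [mul_zero] at h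
  refine h.congr' ?_
  filter_upwards [eventually_ge_atTop 2] with n hn
  have hL := log_natCast_pos hn
  have hn0 : (0 : ℝ) < n := by positivity
  simp only [Function.comp_apply]
  rw [Real.div_rpow (by positivity) hn0.le, Real.mul_rpow hK (by positivity), Real.sqrt_eq_rpow,
    ← Real.rpow_mul (by positivity), Real.mul_rpow (by positivity) hL.le, mul_comm α,
    ← Real.rpow_def_of_pos hn0, show θ - (1 + α) = θ - 1 - α by ring, Real.rpow_sub hn0,
    Real.rpow_sub hn0, Real.rpow_one, show 1 / 2 * θ = θ / 2 by ring]
  field_simp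

set_option maxHeartbeats 1000000 in
lemma tendsto_comparison_sum {r : ℕ → ℝ} {γ : ℝ} (hγ : 0 ≤ γ)
    (hr : Tendsto (fun n : ℕ => r n * log n) atTop (nhds γ)) (h1 : ∀ k, 1 ≤ k → |r k| < 1)
    (c : ℝ) :
    Tendsto (fun n : ℕ => n * ∑ k ∈ Finset.Ico 1 n, |r k - γ / log n| *
      (exp (-(un n c ^ 2 / (1 + max |r k| (γ / log n)))) / √(1 - max |r k| (γ / log n) ^ 2)))
      atTop (nhds 0) := by
  obtain ⟨σ, hσ0, hσ1, hσ⟩ := exists_abs_le_of_tendsto_zero (tendsto_zero_of_tendsto_mul_log hr) h1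
  obtain ⟨M, hM⟩ := hr.abs.bddAbove_range
  have hM' : ∀ n : ℕ, |r n * log n| ≤ M := fun n => hM ⟨n, rfl⟩
  have hγM : γ ≤ M := by
    have := le_of_tendsto' hr.abs hM'
    rwa [abs_of_nonneg hγ] at this
  set θ := 2 / (1 + σ) with hθ
  have hθ1 : 1 < θ := by rw [hθ, lt_div_iff₀ (by positivity)]; linarith
  set α := (θ - 1) / 2 with hα
  have hα0 : 0 < α := by rw [hα]; linarith
  have hα1 : α ≤ 1 := by
    have : θ ≤ 2 := by rw [hθ, div_le_iff₀ (by positivity)]; linarith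
    rw [hα]; linarith
  set K := √(2 * π) * exp (-c) with hK
  set D := (√(1 - σ ^ 2))⁻¹ with hD
  have hρ : Tendsto (fun n : ℕ => γ / log n) atTop (nhds 0) :=
    tendsto_log_natCast.const_div_atTop γ
  set B := D * (2 * K ^ 2 * exp (3 * (M / α))) with hB
  have hces : Tendsto (fun n : ℕ => (n⁻¹ : ℝ) * ∑ k ∈ Finset.range n, |r k * log k - γ|)
      atTop (nhds 0) := by
    have := (hr.sub_const γ).abs
    rw [sub_self, abs_zero] at this
    exact this.cesaro
  have hu := tendsto_un_div (tendsto_const_nhds (x := c))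
  have hlim : Tendsto (fun n : ℕ =>
      2 * D * (n * exp (α * log n) * (K * √(2 * log n) / n) ^ θ) +
      (B / α) * ((n⁻¹ : ℝ) * ∑ k ∈ Finset.range n, |r k * log k - γ|) + (B / α) * (γ / log n))
      atTop (nhds 0) := by
    have := (((tendsto_rpow_mul_log_rpow_div (by positivity : 0 ≤ K)
      (by rw [hα]; linarith : 1 + α < θ)).const_mul (2 * D)).add
      (hces.const_mul (B / α))).add (hρ.const_mul (B / α))
    simpa using this
  refine squeeze_zero' (Eventually.of_forall fun n => by positivity) ?_ hlim
  filter_upwards [eventually_ge_atTop 2, hρ.eventually (gt_mem_nhds hσ0),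
    (hu.pow 2).eventually (gt_mem_nhds (by norm_num : (1 : ℝ) ^ 2 < 3 / 2))] with n hn hρn hun
  have hL := log_natCast_pos hn
  have hn0 : (0 : ℝ) < n := by positivity
  set L := log (n : ℝ) with hLdef
  have hρ0 : 0 ≤ γ / L := by positivity
  have hun2 : un n c ^ 2 ≤ 3 * L := by
    rw [div_pow, Real.sq_sqrt (by positivity), div_lt_iff₀ (by positivity)] at hun
    linarith
  have he := exp_neg_sq_un_le hn c
  rw [← hK, ← hLdef] at he
  set bnear := 2 * D * (K * √(2 * L) / n) ^ θ with hbnear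
  have hbnear0 : 0 ≤ bnear := by positivity
  have key : ∀ k ∈ Finset.Ico 1 n, |r k - γ / L| *
      (exp (-(un n c ^ 2 / (1 + max |r k| (γ / L)))) / √(1 - max |r k| (γ / L) ^ 2)) ≤
      (if log k ≤ α * L then bnear else 0) +
        (B / α / n ^ 2 * |r k * log k - γ| + B / α * (γ / L) / n ^ 2 * (L - log k)) := by
    intro k hk
    rw [Finset.mem_Ico] at hk
    have hk0 : (1 : ℝ) ≤ k := by exact_mod_cast hk.1
    have hkL : log k ≤ L := Real.log_le_log (by positivity) (by exact_mod_cast hk.2.le)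
    set w := max |r k| (γ / L) with hw
    have hw0 : 0 ≤ w := hρ0.trans (le_max_right _ _)
    have hwσ : w ≤ σ := max_le (hσ k hk.1) hρn.le
    have hDw : (√(1 - w ^ 2))⁻¹ ≤ D := by
      have : 0 < 1 - σ ^ 2 := by nlinarith
      exact inv_anti₀ (Real.sqrt_pos.2 this) (Real.sqrt_le_sqrt (by nlinarith))
    have hfar0 : 0 ≤ B / α / n ^ 2 * |r k * log k - γ| + B / α * (γ / L) / n ^ 2 * (L - log k) := by
      have : 0 ≤ L - log k := by linarith
      positivity
    have hq : exp (-(un n c ^ 2 / (1 + w))) / √(1 - w ^ 2) ≤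
        exp (-(un n c ^ 2 / (1 + w))) * D := by
      rw [div_eq_mul_inv]; gcongr
    refine (mul_le_mul_of_nonneg_left hq (abs_nonneg _)).trans ?_
    split_ifs with hlog
    · refine le_add_of_le_of_nonneg ?_ hfar0
      have h2 : |r k - γ / L| ≤ 2 := by
        have := abs_sub (r k) (γ / L)
        rw [abs_of_nonneg hρ0] at this
        linarith [hσ k hk.1]
      have h3 : exp (-(un n c ^ 2 / (1 + w))) ≤ (K * √(2 * L) / n) ^ θ := by
        calc exp (-(un n c ^ 2 / (1 + w))) ≤ exp (-(un n c ^ 2 / (1 + σ))) := by gcongr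
          _ = exp (-un n c ^ 2 / 2) ^ θ := by
            rw [← Real.exp_mul, hθ]; congr 1; field_simp
          _ ≤ _ := Real.rpow_le_rpow (by positivity) he (by positivity)
      calc _ ≤ 2 * ((K * √(2 * L) / n) ^ θ * D) := by gcongr
        _ = _ := by rw [hbnear]; ring
    · rw [zero_add]
      have hlog' : α * L < log k := not_le.1 hlog
      have hlk : 0 < log (k : ℝ) := lt_trans (by positivity) hlog'
      have hwC : w ≤ M / α / L := by
        have hMα : γ ≤ M / α := by
          rw [le_div_iff₀ hα0]; nlinarith
        refine max_le ?_ (by gcongr)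
        have := hM' k
        rw [abs_mul, abs_of_pos hlk] at this
        rw [le_div_iff₀ hL, le_div_iff₀ hα0]
        nlinarith [abs_nonneg (r k)]
      have hexp : exp (-(un n c ^ 2 / (1 + w))) ≤ 2 * K ^ 2 * exp (3 * (M / α)) * (L / n ^ 2) := by
        have e1 : -(un n c ^ 2 / (1 + w)) ≤
            -un n c ^ 2 / 2 + -un n c ^ 2 / 2 + 3 * (M / α) := by
          have h4 : un n c ^ 2 * w ≤ 3 * (M / α) := by
            calc un n c ^ 2 * w ≤ 3 * L * (M / α / L) := by gcongr
              _ = _ := by field_simp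
          have h5 : un n c ^ 2 * (1 - w) ≤ un n c ^ 2 / (1 + w) := by
            rw [le_div_iff₀ (by positivity)]
            nlinarith [mul_nonneg (sq_nonneg (un n c)) (sq_nonneg w)]
          linarith
        refine (Real.exp_le_exp.2 e1).trans ?_
        rw [Real.exp_add, Real.exp_add]
        calc _ ≤ K * √(2 * L) / n * (K * √(2 * L) / n) * exp (3 * (M / α)) := by gcongr
          _ = K ^ 2 * √(2 * L) ^ 2 / n ^ 2 * exp (3 * (M / α)) := by ring
          _ = _ := by rw [Real.sq_sqrt (by positivity)]; ring
      have hdiff : L * |r k - γ / L| ≤ 1 / α * (|r k * log k - γ| + γ / L * (L - log k)) := by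
        have e1 : L * |r k - γ / L| = |L / log k * ((r k * log k - γ) + γ / L * (L - log k))| := by
          rw [← abs_of_pos hL, ← abs_mul, abs_of_pos hL]
          congr 1; field_simp; ring
        rw [e1, abs_mul, abs_of_pos (by positivity)]
        have h6 : L / log k ≤ 1 / α := by
          rw [div_le_div_iff₀ hlk hα0]; linarith
        refine mul_le_mul h6 ((abs_add_le _ _).trans ?_) (abs_nonneg _) (by positivity)
        rw [abs_of_nonneg (mul_nonneg hρ0 (by linarith))]
      calc _ ≤ |r k - γ / L| * (2 * K ^ 2 * exp (3 * (M / α)) * (L / n ^ 2) * D) := by gcongr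
        _ = B / n ^ 2 * (L * |r k - γ / L|) := by rw [hB]; ring
        _ ≤ B / n ^ 2 * (1 / α * (|r k * log k - γ| + γ / L * (L - log k))) := by gcongr
        _ = _ := by ring
  have hsum := Finset.sum_le_sum key
  rw [Finset.sum_add_distrib, Finset.sum_add_distrib, ← Finset.mul_sum, ← Finset.mul_sum,
    ← Finset.sum_filter, Finset.sum_const, nsmul_eq_mul] at hsum
  have hc1 : (((Finset.Ico 1 n).filter fun k : ℕ => log k ≤ α * L).card : ℝ) * bnear ≤
      exp (α * L) * bnear := by gcongr; exact card_filter_log_le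
  have hc2 : ∑ k ∈ Finset.Ico 1 n, |r k * log k - γ| ≤
      ∑ k ∈ Finset.range n, |r k * log k - γ| :=
    Finset.sum_le_sum_of_subset_of_nonneg (fun k hk => by simp at hk ⊢; omega)
      fun _ _ _ => abs_nonneg _
  have hc3 := sum_log_sub_log_le n
  calc _ ≤ n * (exp (α * L) * bnear + (B / α / n ^ 2 * ∑ k ∈ Finset.range n, |r k * log k - γ| +
        B / α * (γ / L) / n ^ 2 * n)) := by
        refine mul_le_mul_of_nonneg_left (hsum.trans ?_) hn0.le
        gcongr
    _ = _ := by rw [hbnear]; field_simp; ring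

/-- A positive definite function on the integers that vanishes at infinity has no value of modulus
one away from the origin; only three points are needed at a time. -/
lemma abs_lt_one_of_quadratic_nonneg {r : ℕ → ℝ} (h0 : r 0 = 1)
    (hpos : ∀ (m k : ℕ) (a b c : ℝ), 0 ≤ a ^ 2 + b ^ 2 + c ^ 2 + 2 * a * b * r m +
      2 * a * c * r (m + k) + 2 * b * c * r k) (hr : Tendsto r atTop (nhds 0))
    {k : ℕ} (hk : 1 ≤ k) : |r k| < 1 := by
  have hle : |r k| ≤ 1 :=
    abs_le.2 ⟨by linarith [hpos 0 k 0 1 1], by linarith [hpos 0 k 0 1 (-1)]⟩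
  refine hle.lt_of_ne fun heq => ?_
  have hs : r k ^ 2 = 1 := by rw [← sq_abs, heq, one_pow]
  have hstep : ∀ m, r (m + k) = r k * r m := fun m => by
    have := hpos m k (-(r (m + k) - r k * r m)) (-r k) 1
    have : (r (m + k) - r k * r m) ^ 2 ≤ 0 := by nlinarith
    nlinarith [pow_eq_zero_iff two_ne_zero |>.1 (le_antisymm this (sq_nonneg _))]
  have habs : ∀ j, |r (j * k)| = 1 := fun j => by
    induction j with
    | zero => simp [h0]
    | succ j ih => rw [Nat.succ_mul, hstep, abs_mul, heq, ih, one_mul]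
  have ht := (hr.comp (tendsto_atTop_mono (fun j => Nat.le_mul_of_pos_right j hk) tendsto_id)).abs
  simp only [Function.comp_def, habs, abs_zero] at ht
  exact one_ne_zero (tendsto_nhds_unique tendsto_const_nhds ht)

section Stationary

variable {Ω : Type*} [MeasurableSpace Ω] {P : Measure Ω} {X : ℕ → Ω → ℝ}

lemma hasGaussianLaw_of_forall_sum {n : ℕ} {V : Ω → Fin n → ℝ} (hV : Measurable V)
    (h : ∀ c : Fin n → ℝ, ∃ v : ℝ≥0,
      Measure.map (fun ω => ∑ i, c i * V ω i) P = gaussianReal 0 v) :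
    HasGaussianLaw V P := by
  refine ⟨⟨fun L => ?_⟩⟩
  obtain ⟨v, hv⟩ := h fun i => L (Pi.single i 1)
  have hL : (fun ω => ∑ i, L (Pi.single i 1) * V ω i) = L ∘ V := by
    funext ω
    have e : V ω = ∑ i, V ω i • (Pi.single i 1 : Fin n → ℝ) := (pi_eq_sum_univ' (V ω))
    rw [Function.comp_apply]
    conv_rhs => rw [e, map_sum]
    simp [mul_comm]
  rw [hL, ← Measure.map_map L.continuous.measurable hV] at hv
  have h1 : ∫ x, L x ∂(P.map V) = 0 := by
    rw [← integral_map (φ := L) L.continuous.measurable.aemeasurable (f := fun x => x)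
      aestronglyMeasurable_id, hv, integral_id_gaussianReal]
  have h2 : Var[L; P.map V] = v := by
    have := variance_map (X := id) (μ := P.map V) (Y := L) aemeasurable_id
      L.continuous.measurable.aemeasurable
    rw [hv, variance_id_gaussianReal, Function.id_comp] at this
    exact this.symm
  rw [hv, h1, h2, Real.toNNReal_coe]

lemma integral_mul_of_stationary (hXmeas : ∀ n, Measurable (X n))
    (hstat : ∀ (m k : ℕ), Measure.map (fun ω => fun i : Fin m => X (i.1 + 1 + k) ω) P =
      Measure.map (fun ω => fun i : Fin m => X (i.1 + 1) ω) P) (i d : ℕ) :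
    ∫ ω, X (i + 1) ω * X (i + d + 1) ω ∂P = ∫ ω, X 1 ω * X (d + 1) ω ∂P := by
  have hf : StronglyMeasurable fun v : Fin (d + 1) → ℝ => v 0 * v (Fin.last d) :=
    (by fun_prop : Continuous _).stronglyMeasurable
  have h1 := integral_map (μ := P) (φ := fun ω => fun a : Fin (d + 1) => X (a.1 + 1 + i) ω)
    (by fun_prop) hf.aestronglyMeasurable
  have h2 := integral_map (μ := P) (φ := fun ω => fun a : Fin (d + 1) => X (a.1 + 1) ω)
    (by fun_prop) hf.aestronglyMeasurable
  rw [hstat, h2] at h1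
  simp only [Fin.val_zero, Fin.val_last, zero_add] at h1
  rw [h1, show i + 1 = 1 + i by ring, show i + d + 1 = d + 1 + i by ring]

lemma memLp_two_of_map_eq (hXmeas : ∀ n, Measurable (X n))
    (hstd : ∀ n, Measure.map (X n) P = gaussianReal 0 1) (n : ℕ) : MemLp (X n) 2 P := by
  have : MemLp id 2 (P.map (X n)) := by rw [hstd]; exact memLp_id_gaussianReal 2
  exact this.comp_of_map (hXmeas n).aemeasurable

lemma integral_eq_zero_of_map_eq (hXmeas : ∀ n, Measurable (X n))
    (hstd : ∀ n, Measure.map (X n) P = gaussianReal 0 1) (n : ℕ) : ∫ ω, X n ω ∂P = 0 := by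
  rw [← integral_map (φ := X n) (hXmeas n).aemeasurable (f := fun x => x) aestronglyMeasurable_id,
    hstd, integral_id_gaussianReal]

lemma variance_eq_one_of_map_eq (hXmeas : ∀ n, Measurable (X n))
    (hstd : ∀ n, Measure.map (X n) P = gaussianReal 0 1) (n : ℕ) : Var[X n; P] = 1 := by
  have := variance_map (X := id) (μ := P) (Y := X n) aemeasurable_id (hXmeas n).aemeasurable
  rw [hstd, variance_id_gaussianReal, Function.id_comp] at this
  simpa using this.symm

lemma integral_mul_self_of_map_eq (hXmeas : ∀ n, Measurable (X n))
    (hstd : ∀ n, Measure.map (X n) P = gaussianReal 0 1) (n : ℕ) :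
    ∫ ω, X n ω * X n ω ∂P = 1 := by
  have h := variance_eq_one_of_map_eq hXmeas hstd n
  rw [variance_of_integral_eq_zero (hXmeas n).aemeasurable
    (integral_eq_zero_of_map_eq hXmeas hstd n)] at h
  simpa only [sq] using h

lemma abs_integral_mul_lt_one (hXmeas : ∀ n, Measurable (X n))
    (hstd : ∀ n, Measure.map (X n) P = gaussianReal 0 1)
    (hstat : ∀ (m k : ℕ), Measure.map (fun ω => fun i : Fin m => X (i.1 + 1 + k) ω) P =
      Measure.map (fun ω => fun i : Fin m => X (i.1 + 1) ω) P)
    (hr : Tendsto (fun n : ℕ => ∫ ω, X 1 ω * X (n + 1) ω ∂P) atTop (nhds 0))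
    {k : ℕ} (hk : 1 ≤ k) : |∫ ω, X 1 ω * X (k + 1) ω ∂P| < 1 := by
  refine abs_lt_one_of_quadratic_nonneg (r := fun n => ∫ ω, X 1 ω * X (n + 1) ω ∂P)
    (integral_mul_self_of_map_eq hXmeas hstd 1) (fun m k a b c => ?_) hr hk
  have hi : ∀ i j, Integrable (fun ω => X i ω * X j ω) P := fun i j =>
    (memLp_two_of_map_eq hXmeas hstd i).integrable_mul (memLp_two_of_map_eq hXmeas hstd j)
  have h : 0 ≤ ∫ ω, (a * X 1 ω + b * X (m + 1) ω + c * X (m + k + 1) ω) ^ 2 ∂P :=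
    integral_nonneg fun ω => sq_nonneg _
  have e : ∀ ω, (a * X 1 ω + b * X (m + 1) ω + c * X (m + k + 1) ω) ^ 2 =
      a ^ 2 * (X 1 ω * X 1 ω) + b ^ 2 * (X (m + 1) ω * X (m + 1) ω) +
      c ^ 2 * (X (m + k + 1) ω * X (m + k + 1) ω) + 2 * a * b * (X 1 ω * X (m + 1) ω) +
      2 * a * c * (X 1 ω * X (m + k + 1) ω) + 2 * b * c * (X (m + 1) ω * X (m + k + 1) ω) :=
    fun ω => by ring
  simp_rw [e] at h
  rw [integral_add, integral_add, integral_add, integral_add, integral_add] at h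
  · simp only [integral_const_mul, integral_mul_self_of_map_eq hXmeas hstd,
      integral_mul_of_stationary hXmeas hstat m k, mul_one] at h
    exact h
  all_goals
    first
    | exact (hi _ _).const_mul _
    | fun_prop (disch := skip)

variable [IsProbabilityMeasure P]

lemma covariance_of_stationary (hXmeas : ∀ n, Measurable (X n))
    (hstd : ∀ n, Measure.map (X n) P = gaussianReal 0 1)
    (hstat : ∀ (m k : ℕ), Measure.map (fun ω => fun i : Fin m => X (i.1 + 1 + k) ω) P =
      Measure.map (fun ω => fun i : Fin m => X (i.1 + 1) ω) P) (i j : ℕ) :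
    cov[X (i + 1), X (j + 1); P] = ∫ ω, X 1 ω * X (Nat.dist i j + 1) ω ∂P := by
  wlog hij : i ≤ j generalizing i j
  · rw [covariance_comm, Nat.dist_comm]; exact this j i (not_le.1 hij).le
  obtain ⟨d, rfl⟩ := Nat.exists_eq_add_of_le hij
  rw [covariance_eq_sub (memLp_two_of_map_eq hXmeas hstd _) (memLp_two_of_map_eq hXmeas hstd _),
    integral_eq_zero_of_map_eq hXmeas hstd, zero_mul, sub_zero,
    Nat.dist_eq_sub_of_le hij, Nat.add_sub_cancel_left]
  exact integral_mul_of_stationary hXmeas hstat i d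

end Stationary

lemma sum_dist_le {n : ℕ} {F : ℕ → ℝ} (hF : ∀ k, 0 ≤ F k) (i : Fin n) :
    ∑ j ∈ Finset.univ.filter (fun j : Fin n => i ≠ j), F (Nat.dist i j) ≤
      2 * ∑ k ∈ Finset.Ico 1 n, F k := by
  have h1 : ∑ j ∈ Finset.univ.filter (fun j : Fin n => i < j), F (Nat.dist i j) ≤
      ∑ k ∈ Finset.Ico 1 n, F k := by
    rw [← Finset.sum_image (g := fun j : Fin n => Nat.dist i j) (f := F)]
    · refine Finset.sum_le_sum_of_subset_of_nonneg (fun k hk => ?_) fun _ _ _ => hF _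
      simp only [Finset.mem_image, Finset.mem_filter, Finset.mem_univ, true_and, Fin.lt_def] at hk
      obtain ⟨j, hj, rfl⟩ := hk
      rw [Nat.dist_eq_sub_of_le hj.le, Finset.mem_Ico]
      omega
    · intro j hj j' hj' h
      simp only [Finset.coe_filter, Finset.mem_univ, true_and, Set.mem_ofPred_eq, Fin.lt_def]
        at hj hj'
      simp only [Nat.dist_eq_sub_of_le hj.le, Nat.dist_eq_sub_of_le hj'.le] at h
      omega
  have h2 : ∑ j ∈ Finset.univ.filter (fun j : Fin n => j < i), F (Nat.dist i j) ≤
      ∑ k ∈ Finset.Ico 1 n, F k := by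
    rw [← Finset.sum_image (g := fun j : Fin n => Nat.dist i j) (f := F)]
    · refine Finset.sum_le_sum_of_subset_of_nonneg (fun k hk => ?_) fun _ _ _ => hF _
      simp only [Finset.mem_image, Finset.mem_filter, Finset.mem_univ, true_and, Fin.lt_def] at hk
      obtain ⟨j, hj, rfl⟩ := hk
      rw [Nat.dist_eq_sub_of_le_right hj.le, Finset.mem_Ico]
      omega
    · intro j hj j' hj' h
      simp only [Finset.coe_filter, Finset.mem_univ, true_and, Set.mem_ofPred_eq, Fin.lt_def]
        at hj hj'
      simp only [Nat.dist_eq_sub_of_le_right hj.le, Nat.dist_eq_sub_of_le_right hj'.le] at h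
      omega
  have e : Finset.univ.filter (fun j : Fin n => i ≠ j) =
      Finset.univ.filter (fun j : Fin n => i < j) ∪
        Finset.univ.filter (fun j : Fin n => j < i) := by
    ext j; simp [lt_or_lt_iff_ne]
  rw [e, Finset.sum_union]
  · linarith
  · rw [Finset.disjoint_filter]; exact fun j _ h => not_lt.2 (le_of_lt h)

lemma prod_Icc_one_eq_prod_fin (n : ℕ) (f : ℕ → ℝ) :
    ∏ k ∈ Finset.Icc 1 n, f k = ∏ i : Fin n, f (i + 1) := by
  rw [Fin.prod_univ_eq_prod_range (fun i => f (i + 1)) n, Finset.range_eq_Ico,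
    Finset.prod_Ico_add' f 0 n 1]
  rfl

lemma un_mono (n : ℕ) : Monotone (un n) := fun x y h => by
  unfold un; gcongr

lemma tendsto_un_atTop (c : ℝ) : Tendsto (fun n => un n c) atTop atTop := by
  have h := (tendsto_un_div (tendsto_const_nhds (x := c))).pos_mul_atTop one_pos
    tendsto_sqrt_two_mul_log
  refine h.congr' ?_
  filter_upwards [tendsto_sqrt_two_mul_log.eventually_gt_atTop 0] with n hn
  field_simp

/-- The sequence `X` may be replaced by an equicorrelated one, uniformly in the way the indices are
divided into observed and unobserved ones. -/
lemma exists_tendsto_zero_comparison {Ω : Type*} [MeasurableSpace Ω] {P : Measure Ω}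
    [IsProbabilityMeasure P] {X : ℕ → Ω → ℝ} {γ : ℝ} (hγ : 0 ≤ γ)
    (hXmeas : ∀ n, Measurable (X n))
    (hGauss : ∀ (m : ℕ) (idx : Fin m → ℕ) (c : Fin m → ℝ), ∃ v : ℝ≥0,
      Measure.map (fun ω => ∑ i, c i * X (idx i) ω) P = gaussianReal 0 v)
    (hstd : ∀ n, Measure.map (X n) P = gaussianReal 0 1)
    (hstat : ∀ (m k : ℕ), Measure.map (fun ω => fun i : Fin m => X (i.1 + 1 + k) ω) P =
      Measure.map (fun ω => fun i : Fin m => X (i.1 + 1) ω) P)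
    (hr : Tendsto (fun n : ℕ => (∫ ω, X 1 ω * X (n + 1) ω ∂P) * log n) atTop (nhds γ))
    {c : Bool → ℝ} (hc0 : ∀ e, 0 ≤ c e) (hc1 : ∀ e, c e ≤ 1) (v : Bool → ℝ) :
    ∃ δ : ℕ → ℝ, Tendsto δ atTop (nhds 0) ∧ ∀ᶠ n : ℕ in atTop, ∀ e : ℕ → Bool,
      |∫ ω, ∏ k ∈ Finset.Icc 1 n, (1 - c (e k) * if un n (v (e k)) < X k ω then 1 else 0) ∂P -
        ∫ z, ∏ k ∈ Finset.Icc 1 n, (1 - c (e k) *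
          gaussianTail ((un n (v (e k)) - √(γ / log n) * z) / √(1 - γ / log n)))
          ∂(gaussianReal 0 1)| ≤ δ n := by
  have hr0 := tendsto_zero_of_tendsto_mul_log hr
  have hlt : ∀ k, 1 ≤ k → |∫ ω, X 1 ω * X (k + 1) ω ∂P| < 1 := fun k hk =>
    abs_integral_mul_lt_one hXmeas hstd hstat hr0 hk
  have hlim := (tendsto_comparison_sum hγ hr hlt (min (v true) (v false))).const_mul 2
  rw [mul_zero] at hlim
  refine ⟨_, hlim, ?_⟩
  have hρ : Tendsto (fun n : ℕ => γ / log n) atTop (nhds 0) :=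
    tendsto_log_natCast.const_div_atTop γ
  filter_upwards [eventually_ge_atTop 2, hρ.eventually (gt_mem_nhds one_pos),
    (tendsto_un_atTop (min (v true) (v false))).eventually_ge_atTop 0] with n hn hρ1 hu0 e
  have hL := log_natCast_pos hn
  set r : ℕ → ℝ := fun k => ∫ ω, X 1 ω * X (k + 1) ω ∂P with hrdef
  have hcov : ∀ i j : Fin n, cov[X (i + 1), X (j + 1); P] = r (Nat.dist i j) := fun i j =>
    covariance_of_stationary hXmeas hstd hstat i j
  have hdist : ∀ i j : Fin n, i ≠ j → 1 ≤ Nat.dist i j := fun i j hij =>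
    Nat.dist_pos_of_ne fun h => hij (Fin.ext h)
  have h := gaussian_comparison_equicorrelated (P := P) (V := fun ω (i : Fin n) => X (i + 1) ω)
    (hasGaussianLaw_of_forall_sum (by fun_prop) fun c => hGauss n (fun i => i + 1) c)
    (by fun_prop) (fun i => integral_eq_zero_of_map_eq hXmeas hstd _)
    (fun i => variance_eq_one_of_map_eq hXmeas hstd _)
    (ρ := γ / log n) (by positivity) hρ1
    (w := fun i j => max |r (Nat.dist i j)| (γ / log n))
    (fun i j hij => max_lt (hlt _ (hdist i j hij)) hρ1)
    (fun i j _ => by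
      change |cov[X (i + 1), X (j + 1); P]| ≤ _
      rw [hcov]; exact le_max_left _ _)
    (fun i j => le_max_right _ _)
    (u := fun i => un n (v (e (i + 1)))) (c := fun i => c (e (i + 1))) hu0
    (fun i => un_mono n (by cases e (i + 1) <;> simp)) (fun _ => hc0 _) (fun _ => hc1 _)
  simp only [prod_Icc_one_eq_prod_fin]
  refine h.trans ?_
  set F : ℕ → ℝ := fun k => |r k - γ / log n| *
    (exp (-(un n (min (v true) (v false)) ^ 2 / (1 + max |r k| (γ / log n)))) /
      √(1 - max |r k| (γ / log n) ^ 2)) with hF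
  have hrow : ∀ i : Fin n, ∑ j : Fin n,
      |cov[fun ω => X (i + 1) ω, fun ω => X (j + 1) ω; P] - if i = j then 1 else γ / log n| *
        (exp (-(un n (min (v true) (v false)) ^ 2 / (1 + max |r (Nat.dist i j)| (γ / log n)))) /
          √(1 - max |r (Nat.dist i j)| (γ / log n) ^ 2)) ≤ 2 * ∑ k ∈ Finset.Ico 1 n, F k := by
    intro i
    refine le_trans (le_of_eq ?_) (sum_dist_le (F := F) (fun k => by positivity) i)
    rw [Finset.sum_filter]
    refine Finset.sum_congr rfl fun j _ => ?_
    have hc : cov[fun ω => X (i + 1) ω, fun ω => X (j + 1) ω; P] = r (Nat.dist i j) := hcov i j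
    rw [hc]
    by_cases hij : i = j
    · subst hij
      have : r 0 = 1 := integral_mul_self_of_map_eq hXmeas hstd 1
      simp [Nat.dist_self, this]
    · simp [hij, hF]
  refine (Finset.sum_le_sum (g := fun _ => 2 * ∑ k ∈ Finset.Ico 1 n, F k) fun i _ => ?_).trans
    (le_of_eq ?_)
  · exact le_trans (le_of_eq (Finset.sum_congr rfl fun j _ => by congr)) (hrow i)
  rw [Finset.sum_const, Finset.card_univ, Fintype.card_fin, nsmul_eq_mul]
  ring

lemma measurable_poissonMeasure : Measurable poissonMeasure := by
  refine Measure.measurable_of_measurable_coe _ fun s hs => ?_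
  simp only [poissonMeasure, Measure.sum_apply _ hs, Measure.smul_apply, smul_eq_mul]
  fun_prop

lemma integral_pow_poissonMeasure (r : ℝ≥0) (a : ℝ) :
    ∫ n, a ^ n ∂(poissonMeasure r) = exp (-((1 - a) * r)) := by
  have h : exp (r * a) = ∑' n : ℕ, (r * a : ℝ) ^ n / (Nat.factorial n : ℝ) := by
    rw [Real.exp_eq_exp_ℝ, NormedSpace.exp_eq_tsum_div]
  rw [integral_poissonMeasure, show -((1 - a) * r) = -r + r * a by ring, Real.exp_add, h,
    ← tsum_mul_left]
  refine tsum_congr fun n => ?_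
  rw [smul_eq_mul, mul_pow]; ring

lemma measureReal_poissonMeasure_Iio (r : ℝ≥0) (k : ℕ) :
    (poissonMeasure r).real (Set.Iio k) =
      ∑ s ∈ Finset.range k, (r : ℝ) ^ s / (Nat.factorial s : ℝ) * exp (-r) := by
  rw [← Finset.coe_Iio, ← sum_measureReal_singleton, Nat.Iio_eq_range]
  refine Finset.sum_congr rfl fun s _ => ?_
  rw [poissonMeasure_real_singleton]; ring

/-- On the unit square, convergence of mixed moments implies weak convergence. -/
lemma tendsto_integral_of_tendsto_moments {μ : ℕ → Measure (unitInterval × unitInterval)}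
    {μ₀ : Measure (unitInterval × unitInterval)}
    [∀ n, IsProbabilityMeasure (μ n)] [IsProbabilityMeasure μ₀]
    (h : ∀ i j : ℕ, Tendsto (fun n => ∫ p, (p.1 : ℝ) ^ i * (p.2 : ℝ) ^ j ∂(μ n)) atTop
      (nhds (∫ p, (p.1 : ℝ) ^ i * (p.2 : ℝ) ^ j ∂μ₀))) (f : C(unitInterval × unitInterval, ℝ)) :
    Tendsto (fun n => ∫ p, f p ∂(μ n)) atTop (nhds (∫ p, f p ∂μ₀)) := by
  have hint : ∀ (ν : Measure (unitInterval × unitInterval)) [IsProbabilityMeasure ν]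
      (f : C(unitInterval × unitInterval, ℝ)),
      Integrable f ν := fun ν _ f =>
    f.continuous.integrable_of_hasCompactSupport (HasCompactSupport.of_compactSpace _)
  have hbd : ∀ (ν : Measure (unitInterval × unitInterval)) [IsProbabilityMeasure ν]
      (f₁ f₂ : C(unitInterval × unitInterval, ℝ)),
      dist (∫ p, f₁ p ∂ν) (∫ p, f₂ p ∂ν) ≤ dist f₁ f₂ := fun ν _ f₁ f₂ => by
    rw [dist_eq_norm, ← integral_sub (hint ν f₁) (hint ν f₂)]
    refine (norm_integral_le_of_norm_le_const (ae_of_all _ fun p => ?_)).trans_eq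
      (by rw [probReal_univ, mul_one])
    rw [← dist_eq_norm]
    exact ContinuousMap.dist_apply_le_dist p
  let x : C(unitInterval × unitInterval, ℝ) := ⟨fun p => p.1, by fun_prop⟩
  let y : C(unitInterval × unitInterval, ℝ) := ⟨fun p => p.2, by fun_prop⟩
  let S : Submodule ℝ C(unitInterval × unitInterval, ℝ) :=
    { carrier := {f | Tendsto (fun n => ∫ p, f p ∂(μ n)) atTop (nhds (∫ p, f p ∂μ₀))}
      zero_mem' := by simp
      add_mem' := fun {f₁ f₂} h₁ h₂ => by
        have := h₁.add h₂
        simp only [← integral_add (hint _ f₁) (hint _ f₂)] at this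
        exact this
      smul_mem' := fun c f hf => by
        have := hf.const_mul c
        simp only [← integral_const_mul] at this
        exact this }
  have hS : Subalgebra.toSubmodule (Algebra.adjoin ℝ {x, y}) ≤ S := by
    rw [Algebra.adjoin_eq_span, Submodule.span_le]
    intro f hf
    obtain ⟨i, j, rfl⟩ := (Submonoid.mem_closure_pair x y f).1 hf
    exact h i j
  have hdense : f ∈ (Algebra.adjoin ℝ {x, y}).topologicalClosure := by
    rw [ContinuousMap.subalgebra_topologicalClosure_eq_top_of_separatesPoints]
    · trivial
    · rintro p q hpq
      by_cases h1 : p.1 = q.1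
      · exact ⟨y, ⟨y, Algebra.subset_adjoin (by simp), rfl⟩,
          fun h2 => hpq (Prod.ext h1 (Subtype.ext h2))⟩
      · exact ⟨x, ⟨x, Algebra.subset_adjoin (by simp), rfl⟩, fun h2 => h1 (Subtype.ext h2)⟩
  rw [Metric.tendsto_atTop]
  intro δ hδ
  obtain ⟨f', hf', hff'⟩ := Metric.mem_closure_iff.1 hdense (δ / 3) (by positivity)
  obtain ⟨N, hN⟩ := Metric.tendsto_atTop.1 (hS hf') (δ / 3) (by positivity)
  refine ⟨N, fun n hn => ?_⟩
  have h1 := hbd (μ n) f f'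
  have h2 := hbd μ₀ f' f
  rw [dist_comm f' f] at h2
  linarith [dist_triangle4 (∫ p, f p ∂(μ n)) (∫ p, f' p ∂(μ n)) (∫ p, f' p ∂μ₀) (∫ p, f p ∂μ₀),
    hN n hn]

/-- Continuity theorem for bivariate probability generating functions. -/
lemma tendsto_measureReal_of_tendsto_pgf {ν : ℕ → Measure (ℕ × ℕ)} {ν₀ : Measure (ℕ × ℕ)}
    [∀ n, IsProbabilityMeasure (ν n)] [IsProbabilityMeasure ν₀]
    (h : ∀ a b : ℝ, 0 ≤ a → a ≤ 1 → 0 ≤ b → b ≤ 1 →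
      Tendsto (fun n => ∫ p, a ^ p.1 * b ^ p.2 ∂(ν n)) atTop (nhds (∫ p, a ^ p.1 * b ^ p.2 ∂ν₀)))
    (k l : ℕ) :
    Tendsto (fun n => (ν n).real (Set.Iio k ×ˢ Set.Iio l)) atTop
      (nhds (ν₀.real (Set.Iio k ×ˢ Set.Iio l))) := by
  let half : unitInterval := ⟨1 / 2, by norm_num, by norm_num⟩
  let φ : ℕ × ℕ → unitInterval × unitInterval := fun p => (half ^ p.1, half ^ p.2)
  have hφ : Measurable φ := Measurable.of_discrete
  have hmap : ∀ (ν : Measure (ℕ × ℕ)) (f : unitInterval × unitInterval → ℝ), Continuous f →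
      ∫ p, f p ∂(ν.map φ) = ∫ p, f (φ p) ∂ν := fun ν f hf =>
    integral_map hφ.aemeasurable hf.aestronglyMeasurable
  have hprob : ∀ (ν : Measure (ℕ × ℕ)) [IsProbabilityMeasure ν], IsProbabilityMeasure (ν.map φ) :=
    fun ν _ => Measure.isProbabilityMeasure_map hφ.aemeasurable
  have := fun n => hprob (ν n)
  have := hprob ν₀
  let bump : ℕ → ℝ → ℝ := fun k u => max 0 (min 1 (2 ^ k * u - 1))
  have hbump : ∀ k s : ℕ, bump k ((1 / 2) ^ s) = if s < k then 1 else 0 := fun k s => by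
    simp only [bump]
    split_ifs with hs
    · obtain ⟨d, rfl⟩ := Nat.exists_eq_add_of_lt hs
      have : (2 : ℝ) ^ (s + d + 1) * (1 / 2) ^ s = 2 * 2 ^ d := by
        rw [pow_succ, pow_add, one_div, inv_pow]; field_simp
      rw [this, min_eq_left (by linarith [one_le_pow₀ (one_le_two : (1 : ℝ) ≤ 2) (n := d)]),
        max_eq_right zero_le_one]
    · obtain ⟨d, rfl⟩ := Nat.exists_eq_add_of_le (not_lt.1 hs)
      have : (2 : ℝ) ^ k * (1 / 2) ^ (k + d) = (1 / 2) ^ d := by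
        rw [pow_add, one_div, inv_pow, inv_pow]; field_simp
      rw [this]
      refine max_eq_left ((min_le_right _ _).trans ?_)
      linarith [pow_le_one₀ (by norm_num : (0 : ℝ) ≤ 1 / 2) (by norm_num) (n := d)]
  let f : C(unitInterval × unitInterval, ℝ) := ⟨fun p => bump k p.1 * bump l p.2, by
    simp only [bump]; fun_prop⟩
  have hf : ∀ (ν : Measure (ℕ × ℕ)), ∫ p, f p ∂(ν.map φ) = ν.real (Set.Iio k ×ˢ Set.Iio l) :=
    fun ν => by
    rw [hmap ν f f.continuous, ← integral_indicator_one (by measurability)]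
    refine integral_congr_ae (ae_of_all _ fun p => ?_)
    change bump k (((1 / 2 : ℝ)) ^ p.1) * bump l ((1 / 2 : ℝ) ^ p.2) = _
    rw [hbump, hbump, Set.indicator_apply]
    by_cases h1 : p.1 < k <;> by_cases h2 : p.2 < l <;> simp [h1, h2]
  simp only [← hf]
  refine tendsto_integral_of_tendsto_moments (fun i j => ?_) f
  simp only [hmap _ (fun p : unitInterval × unitInterval => (p.1 : ℝ) ^ i * (p.2 : ℝ) ^ j)
    (by fun_prop)]
  have hpow : ∀ p : ℕ × ℕ, ((φ p).1 : ℝ) ^ i * ((φ p).2 : ℝ) ^ j =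
      ((1 / 2 : ℝ) ^ i) ^ p.1 * ((1 / 2 : ℝ) ^ j) ^ p.2 := fun p => by
    change ((1 / 2 : ℝ) ^ p.1) ^ i * ((1 / 2 : ℝ) ^ p.2) ^ j = _
    rw [pow_right_comm, pow_right_comm (1 / 2 : ℝ) j]
  simp only [hpow]
  exact h _ _ (by positivity) (pow_le_one₀ (by norm_num) (by norm_num)) (by positivity)
    (pow_le_one₀ (by norm_num) (by norm_num))

lemma integrable_of_measurable_of_abs_le_one {α : Type*} [MeasurableSpace α] {μ : Measure α}
    [IsProbabilityMeasure μ] {f : α → ℝ} (hf : Measurable f) (h : ∀ x, |f x| ≤ 1) :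
    Integrable f μ :=
  Integrable.of_bound hf.aestronglyMeasurable 1 (ae_of_all _ h)

lemma abs_pow_div_factorial_mul_exp_le_one {r : ℝ} (hr : 0 ≤ r) (s : ℕ) :
    |r ^ s / (Nat.factorial s : ℝ) * exp (-r)| ≤ 1 := by
  rw [abs_of_nonneg (by positivity), exp_neg, ← div_eq_mul_inv]
  exact div_le_one_of_le₀ (pow_div_factorial_le_exp r hr s) (exp_pos r).le

/-- The law of a pair of counts which are conditionally independent Poisson variables, with random
rates `A` and `B`. -/
noncomputable def mixedPoisson {Ω : Type*} [MeasurableSpace Ω] (Q : Measure Ω) {A B : Ω → ℝ≥0}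
    (hA : Measurable A) (hB : Measurable B) : Measure (ℕ × ℕ) :=
  (Q ⊗ₘ ((⟨fun ω => poissonMeasure (A ω), measurable_poissonMeasure.comp hA⟩ : Kernel Ω ℕ) ×ₖ
    (⟨fun ω => poissonMeasure (B ω), measurable_poissonMeasure.comp hB⟩ : Kernel Ω ℕ))).snd

section MixedPoisson

variable {Ω : Type*} [MeasurableSpace Ω] {Q : Measure Ω} [IsProbabilityMeasure Q] {A B : Ω → ℝ≥0}
  (hA : Measurable A) (hB : Measurable B)

lemma isProbabilityMeasure_mixedPoisson : IsProbabilityMeasure (mixedPoisson Q hA hB) := by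
  have h1 : IsMarkovKernel
      (⟨fun ω => poissonMeasure (A ω), measurable_poissonMeasure.comp hA⟩ : Kernel Ω ℕ) :=
    ⟨fun ω => inferInstanceAs (IsProbabilityMeasure (poissonMeasure (A ω)))⟩
  have h2 : IsMarkovKernel
      (⟨fun ω => poissonMeasure (B ω), measurable_poissonMeasure.comp hB⟩ : Kernel Ω ℕ) :=
    ⟨fun ω => inferInstanceAs (IsProbabilityMeasure (poissonMeasure (B ω)))⟩
  unfold mixedPoisson
  infer_instance

lemma integral_mixedPoisson {f h : ℕ → ℝ} (hf : ∀ s, |f s| ≤ 1) (hh : ∀ t, |h t| ≤ 1) :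
    ∫ p, f p.1 * h p.2 ∂(mixedPoisson Q hA hB) =
      ∫ ω, (∫ s, f s ∂(poissonMeasure (A ω))) * ∫ t, h t ∂(poissonMeasure (B ω)) ∂Q := by
  have h1 : IsMarkovKernel
      (⟨fun ω => poissonMeasure (A ω), measurable_poissonMeasure.comp hA⟩ : Kernel Ω ℕ) :=
    ⟨fun ω => inferInstanceAs (IsProbabilityMeasure (poissonMeasure (A ω)))⟩
  have h2 : IsMarkovKernel
      (⟨fun ω => poissonMeasure (B ω), measurable_poissonMeasure.comp hB⟩ : Kernel Ω ℕ) :=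
    ⟨fun ω => inferInstanceAs (IsProbabilityMeasure (poissonMeasure (B ω)))⟩
  have hm : Measurable fun p : ℕ × ℕ => f p.1 * h p.2 := Measurable.of_discrete
  rw [mixedPoisson, Measure.snd, integral_map measurable_snd.aemeasurable hm.aestronglyMeasurable,
    Measure.integral_compProd]
  · refine integral_congr_ae (ae_of_all _ fun ω => ?_)
    simp only [Kernel.prod_apply, Kernel.coe_mk]
    exact integral_prod_mul f h
  · refine integrable_of_measurable_of_abs_le_one (hm.comp measurable_snd) fun p => ?_
    rw [abs_mul]
    exact mul_le_one₀ (hf _) (abs_nonneg _) (hh _)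

lemma integral_pow_mul_pow_mixedPoisson {a b : ℝ} (ha0 : 0 ≤ a) (ha1 : a ≤ 1) (hb0 : 0 ≤ b)
    (hb1 : b ≤ 1) :
    ∫ p, a ^ p.1 * b ^ p.2 ∂(mixedPoisson Q hA hB) =
      ∫ ω, exp (-((1 - a) * A ω)) * exp (-((1 - b) * B ω)) ∂Q := by
  rw [integral_mixedPoisson hA hB (f := fun s => a ^ s) (h := fun t => b ^ t)]
  · simp only [integral_pow_poissonMeasure]
  · exact fun s => abs_le.2 ⟨by linarith [pow_nonneg ha0 s], pow_le_one₀ ha0 ha1⟩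
  · exact fun s => abs_le.2 ⟨by linarith [pow_nonneg hb0 s], pow_le_one₀ hb0 hb1⟩

lemma measureReal_mixedPoisson (k l : ℕ) :
    (mixedPoisson Q hA hB).real (Set.Iio k ×ˢ Set.Iio l) =
      ∑ s ∈ Finset.range k, ∑ t ∈ Finset.range l,
        ∫ ω, (A ω : ℝ) ^ s / (Nat.factorial s : ℝ) * exp (-A ω) *
          ((B ω : ℝ) ^ t / (Nat.factorial t : ℝ) * exp (-B ω)) ∂Q := by
  have hind : ∀ (S : Set ℕ) s, |S.indicator (1 : ℕ → ℝ) s| ≤ 1 := fun S s => by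
    rw [Set.indicator_apply]; split_ifs <;> simp
  have e : (mixedPoisson Q hA hB).real (Set.Iio k ×ˢ Set.Iio l) =
      ∫ p, (Set.Iio k).indicator (1 : ℕ → ℝ) p.1 * (Set.Iio l).indicator (1 : ℕ → ℝ) p.2
        ∂(mixedPoisson Q hA hB) := by
    rw [← integral_indicator_one (by measurability)]
    refine integral_congr_ae (ae_of_all _ fun p => ?_)
    by_cases h1 : p.1 < k <;> by_cases h2 : p.2 < l <;> simp [h1, h2]
  have hint : ∀ s t : ℕ, Integrable (fun ω => (A ω : ℝ) ^ s / (Nat.factorial s : ℝ) *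
      exp (-A ω) * ((B ω : ℝ) ^ t / (Nat.factorial t : ℝ) * exp (-B ω))) Q := fun s t => by
    refine integrable_of_measurable_of_abs_le_one (by fun_prop) fun ω => ?_
    rw [abs_mul]
    exact mul_le_one₀ (abs_pow_div_factorial_mul_exp_le_one (A ω).2 s) (abs_nonneg _)
      (abs_pow_div_factorial_mul_exp_le_one (B ω).2 t)
  rw [e, integral_mixedPoisson hA hB (hind _) (hind _)]
  simp only [integral_indicator_one measurableSet_Iio, measureReal_poissonMeasure_Iio,
    Finset.sum_mul_sum]
  rw [integral_finsetSum _ fun s _ => integrable_finsetSum _ fun t _ => hint s t]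
  exact Finset.sum_congr rfl fun s _ => integral_finsetSum _ fun t _ => hint s t

end MixedPoisson

lemma antitone_gaussianTail : Antitone gaussianTail := fun _ _ h =>
  measureReal_mono (Set.Ioi_subset_Ioi h)

lemma prod_bool_eq_pow_mul_pow {ι : Type*} (s : Finset ι) (e : ι → Bool) (F : Bool → ℝ) :
    ∏ k ∈ s, F (e k) = F true ^ (s.filter fun k => e k = true).card *
      F false ^ (s.card - (s.filter fun k => e k = true).card) := by
  have : ∀ k, F (e k) = if e k = true then F true else F false := fun k => by
    cases e k <;> simp
  simp only [this]
  rw [Finset.prod_ite, Finset.prod_const, Finset.prod_const,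
    ← Finset.card_filter_add_card_filter_not (s := s) (fun k => e k = true),
    Nat.add_sub_cancel_left]

lemma tendsto_one_sub_pow {u : ℕ → ℝ} {t θ : ℝ}
    (hu : Tendsto (fun n : ℕ => n * u n) atTop (nhds t)) {N m : ℕ → ℕ}
    (hN : Tendsto N atTop atTop) (hm : Tendsto (fun i => (m i : ℝ) / N i) atTop (nhds θ)) :
    Tendsto (fun i => (1 - u (N i)) ^ m i) atTop (nhds (exp (-(θ * t)))) := by
  have h0 : Tendsto u atTop (nhds 0) := by
    refine (hu.div_atTop tendsto_natCast_atTop_atTop).congr' ?_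
    filter_upwards [eventually_gt_atTop 0] with n hn
    have : (0 : ℝ) < n := by exact_mod_cast hn
    field_simp
  have h1 : Tendsto (fun n => (1 - u n) ^ n) atTop (nhds (exp (-t))) := by
    have := Real.tendsto_one_add_pow_exp_of_tendsto (g := fun n => -u n) (t := -t)
      (by simpa using hu.neg)
    simpa only [← sub_eq_add_neg] using this
  have h2 := (h1.comp hN).rpow hm (Or.inl (Real.exp_pos _).ne')
  rw [← Real.exp_mul, show -t * θ = -(θ * t) by ring] at h2
  refine h2.congr' ?_
  filter_upwards [hN.eventually_gt_atTop 0,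
    hN.eventually (h0.eventually (gt_mem_nhds zero_lt_one))] with i hi hu1
  have hi' : (0 : ℝ) < N i := by exact_mod_cast hi
  simp only [Function.comp_apply]
  rw [← Real.rpow_natCast, ← Real.rpow_mul (by linarith), mul_div_cancel₀ _ hi'.ne',
    Real.rpow_natCast]

lemma tendsto_prod_of_tendsto_card {q : Bool → ℕ → ℝ} {G : Bool → ℝ}
    (hq : ∀ b, Tendsto (fun n : ℕ => n * q b n) atTop (nhds (G b))) (e : ℕ → Bool) {N : ℕ → ℕ}
    (hN : Tendsto N atTop atTop) {θ : ℝ}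
    (hθ : Tendsto (fun i => (∑ k ∈ Finset.Icc 1 (N i), if e k then (1 : ℝ) else 0) / N i) atTop
      (nhds θ)) :
    Tendsto (fun i => ∏ k ∈ Finset.Icc 1 (N i), (1 - q (e k) (N i))) atTop
      (nhds (exp (-(θ * G true)) * exp (-((1 - θ) * G false)))) := by
  have hcard : ∀ i, (∑ k ∈ Finset.Icc 1 (N i), if e k then (1 : ℝ) else 0) =
      (((Finset.Icc 1 (N i)).filter fun k => e k = true).card : ℝ) := fun i => by
    rw [Finset.sum_boole]
  simp only [hcard] at hθ
  have hθ' : Tendsto (fun i => ((N i - ((Finset.Icc 1 (N i)).filter fun k => e k = true).card : ℕ)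
      : ℝ) / N i) atTop (nhds (1 - θ)) := by
    refine (hθ.const_sub 1).congr' ?_
    filter_upwards [hN.eventually_gt_atTop 0] with i hi
    have hi' : (0 : ℝ) < N i := by exact_mod_cast hi
    have := Finset.card_filter_le (Finset.Icc 1 (N i)) fun k => e k = true
    rw [Nat.card_Icc, Nat.add_sub_cancel] at this
    rw [Nat.cast_sub this]
    field_simp
  refine ((tendsto_one_sub_pow (hq true) hN hθ).mul
    (tendsto_one_sub_pow (hq false) hN hθ')).congr fun i => ?_
  rw [prod_bool_eq_pow_mul_pow _ e fun b => 1 - q b (N i), Nat.card_Icc, Nat.add_sub_cancel]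

lemma abs_prod_one_sub_le_one {ι : Type*} (s : Finset ι) {f : ι → ℝ} (h0 : ∀ i, 0 ≤ f i)
    (h1 : ∀ i, f i ≤ 1) : |∏ i ∈ s, (1 - f i)| ≤ 1 := by
  rw [Finset.abs_prod]
  exact Finset.prod_le_one (fun i _ => abs_nonneg _) fun i _ =>
    abs_le.2 ⟨by linarith [h1 i], by linarith [h0 i]⟩

lemma measurable_bool_comp {α β : Type*} [MeasurableSpace α] [MeasurableSpace β] {e : α → Bool}
    (he : Measurable e) {F : Bool → α → β} (hF : ∀ b, Measurable (F b)) :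
    Measurable fun a => F (e a) a :=
  (measurable_from_prod_countable_right (f := fun p : Bool × α => F p.1 p.2) hF).comp
    (he.prodMk measurable_id)

lemma measurable_prod_one_sub {α : Type*} [MeasurableSpace α] {e : ℕ → α → Bool}
    (he : ∀ k, Measurable (e k)) {q : Bool → ℕ → α → ℝ} (hq : ∀ b k, Measurable (q b k))
    (s : Finset ℕ) : Measurable fun a => ∏ k ∈ s, (1 - q (e k a) k a) :=
  Finset.measurable_fun_prod _ fun k _ =>
    (measurable_bool_comp (he k) (F := fun b => q b k) fun b => hq b k).const_sub 1

/-- Given the labels and the value of the mixing variable, the number of exceedances of either label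
is asymptotically Poisson. -/
lemma tendsto_integral_prod_of_tendstoInMeasure {Ω : Type*} [MeasurableSpace Ω] {P : Measure Ω}
    [IsProbabilityMeasure P] {ε : ℕ → Ω → Bool} {lam : Ω → ℝ} (hε : ∀ n, Measurable (ε n))
    (hS : TendstoInMeasure P
      (fun n ω => (∑ k ∈ Finset.Icc 1 n, (if ε k ω then (1 : ℝ) else 0)) / n) atTop lam)
    {μ : Measure ℝ} [IsProbabilityMeasure μ] {q : Bool → ℕ → ℝ → ℝ} {G : Bool → ℝ → ℝ}
    (hqm : ∀ b n, Measurable (q b n)) (hq0 : ∀ b n z, 0 ≤ q b n z) (hq1 : ∀ b n z, q b n z ≤ 1)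
    (hq : ∀ b z, Tendsto (fun n : ℕ => n * q b n z) atTop (nhds (G b z))) :
    Tendsto (fun n => ∫ p, ∏ k ∈ Finset.Icc 1 n, (1 - q (ε k p.1) n p.2) ∂(P.prod μ)) atTop
      (nhds (∫ p, exp (-(lam p.1 * G true p.2)) * exp (-((1 - lam p.1) * G false p.2))
        ∂(P.prod μ))) := by
  refine tendsto_of_subseq_tendsto fun ns hns => ?_
  have hS' : TendstoInMeasure P
      (fun i ω => (∑ k ∈ Finset.Icc 1 (ns i), (if ε k ω then (1 : ℝ) else 0)) / ns i) atTop lam :=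
    fun δ hδ => (hS δ hδ).comp hns
  obtain ⟨ms, hms, hae⟩ := hS'.exists_seq_tendsto_ae
  refine ⟨ms, tendsto_integral_of_dominated_convergence (fun _ => 1) (fun i => ?_)
    (integrable_const _) (fun i => ae_of_all _ fun p => ?_) ?_⟩
  · exact (measurable_prod_one_sub (fun k => (hε k).comp measurable_fst)
      (q := fun b _ p => q b (ns (ms i)) p.2) (fun b _ => (hqm _ _).comp measurable_snd)
      _).aestronglyMeasurable
  · exact abs_prod_one_sub_le_one _ (fun _ => hq0 _ _ _) fun _ => hq1 _ _ _
  · filter_upwards [Measure.quasiMeasurePreserving_fst.ae hae] with p hp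
    exact tendsto_prod_of_tendsto_card (fun b => hq b p.2) (fun k => ε k p.1)
      (hns.comp hms.tendsto_atTop) hp

lemma integral_comp_eq_of_indepFun {Ω α β : Type*} [MeasurableSpace Ω] [MeasurableSpace α]
    [MeasurableSpace β] {P : Measure Ω} [IsProbabilityMeasure P] {X : Ω → α} {Y : Ω → β}
    (hX : Measurable X) (hY : Measurable Y) (h : IndepFun X Y P) {F : α × β → ℝ}
    (hF : Measurable F) (hF1 : ∀ p, |F p| ≤ 1) :
    ∫ ω, F (X ω, Y ω) ∂P = ∫ ω', ∫ ω, F (X ω, Y ω') ∂P ∂P := by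
  have hmap := (indepFun_iff_map_prod_eq_prod_map_map hX.aemeasurable hY.aemeasurable).1 h
  rw [← integral_map (f := F) (hX.prodMk hY).aemeasurable hF.aestronglyMeasurable, hmap,
    Measure.map_prod_map _ _ hX hY,
    integral_map (by fun_prop) hF.aestronglyMeasurable]
  exact integral_prod_symm (fun p => F (Prod.map X Y p)) (integrable_of_measurable_of_abs_le_one
    (hF.comp (hX.prodMap hY)) fun p => hF1 _)

lemma abs_integral_sub_integral_le {Ω : Type*} [MeasurableSpace Ω] {P : Measure Ω}
    [IsProbabilityMeasure P] {f h : Ω → ℝ} (hf : Integrable f P) (hh : Integrable h P) {δ : ℝ}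
    (hδ : ∀ ω, |f ω - h ω| ≤ δ) : |∫ ω, f ω ∂P - ∫ ω, h ω ∂P| ≤ δ := by
  rw [← integral_sub hf hh]
  simpa using norm_integral_le_of_norm_le_const (μ := P) (f := fun ω => f ω - h ω) (C := δ)
    (ae_of_all _ hδ)

/-- The limit of the joint probability generating function of the numbers of observed and unobserved
exceedances. -/
lemma tendsto_integral_prod_indicator {Ω : Type*} [MeasurableSpace Ω] {P : Measure Ω}
    [IsProbabilityMeasure P] {X : ℕ → Ω → ℝ} {ε : ℕ → Ω → Bool} {lam : Ω → ℝ} {γ : ℝ}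
    (hγ : 0 ≤ γ) (hXmeas : ∀ n, Measurable (X n)) (hεmeas : ∀ n, Measurable (ε n))
    (hGauss : ∀ (m : ℕ) (idx : Fin m → ℕ) (c : Fin m → ℝ), ∃ v : ℝ≥0,
      Measure.map (fun ω => ∑ i, c i * X (idx i) ω) P = gaussianReal 0 v)
    (hstd : ∀ n, Measure.map (X n) P = gaussianReal 0 1)
    (hstat : ∀ (m k : ℕ), Measure.map (fun ω => fun i : Fin m => X (i.1 + 1 + k) ω) P =
      Measure.map (fun ω => fun i : Fin m => X (i.1 + 1) ω) P)
    (hr : Tendsto (fun n : ℕ => (∫ ω, X 1 ω * X (n + 1) ω ∂P) * log n) atTop (nhds γ))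
    (hindep : IndepFun (fun ω => fun n => X n ω) (fun ω => fun n => ε n ω) P)
    (hS : TendstoInMeasure P
      (fun n ω => (∑ k ∈ Finset.Icc 1 n, (if ε k ω then (1 : ℝ) else 0)) / n) atTop lam)
    {c : Bool → ℝ} (hc0 : ∀ e, 0 ≤ c e) (hc1 : ∀ e, c e ≤ 1) (v : Bool → ℝ) :
    Tendsto (fun n => ∫ ω, ∏ k ∈ Finset.Icc 1 n,
        (1 - c (ε k ω) * if un n (v (ε k ω)) < X k ω then 1 else 0) ∂P) atTop
      (nhds (∫ p, exp (-(lam p.1 * (c true * g γ (v true) p.2))) *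
        exp (-((1 - lam p.1) * (c false * g γ (v false) p.2))) ∂(P.prod (gaussianReal 0 1)))) := by
  obtain ⟨δ, hδ0, hδ⟩ := exists_tendsto_zero_comparison hγ hXmeas hGauss hstd hstat hr hc0 hc1 v
  set q : Bool → ℕ → ℝ → ℝ := fun b n z =>
    c b * gaussianTail ((un n (v b) - √(γ / log n) * z) / √(1 - γ / log n)) with hqdef
  have hqm : ∀ b n, Measurable (q b n) := fun b n =>
    (antitone_gaussianTail.measurable.comp (by fun_prop)).const_mul _
  have hq0 : ∀ b n z, 0 ≤ q b n z := fun b n z => mul_nonneg (hc0 b) measureReal_nonneg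
  have hq1 : ∀ b n z, q b n z ≤ 1 := fun b n z =>
    mul_le_one₀ (hc1 b) measureReal_nonneg measureReal_le_one
  have hq : ∀ b z, Tendsto (fun n : ℕ => n * q b n z) atTop (nhds (c b * g γ (v b) z)) :=
    fun b z => ((tendsto_natCast_mul_gaussianTail_mixture hγ (v b) z).const_mul (c b)).congr
      fun n => by simp only [hqdef]; ring
  have hlim := tendsto_integral_prod_of_tendstoInMeasure (μ := gaussianReal 0 1) hεmeas hS hqm hq0
    hq1 hq
  have hKint : ∀ n, Integrable (fun p : Ω × ℝ => ∏ k ∈ Finset.Icc 1 n, (1 - q (ε k p.1) n p.2))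
      (P.prod (gaussianReal 0 1)) := fun n =>
    integrable_of_measurable_of_abs_le_one
      (measurable_prod_one_sub (fun k => (hεmeas k).comp measurable_fst)
        (q := fun b _ p => q b n p.2) (fun b _ => (hqm _ _).comp measurable_snd) _)
      fun p => abs_prod_one_sub_le_one _ (fun _ => hq0 _ _ _) fun _ => hq1 _ _ _
  set F : ℕ → (ℕ → ℝ) × (ℕ → Bool) → ℝ := fun n p => ∏ k ∈ Finset.Icc 1 n,
    (1 - c (p.2 k) * if un n (v (p.2 k)) < p.1 k then 1 else 0) with hFdef
  have hFm : ∀ n, Measurable (F n) := fun n =>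
    measurable_prod_one_sub (e := fun k p => p.2 k)
      (fun k => (measurable_pi_apply k).comp measurable_snd)
      (q := fun b k (p : (ℕ → ℝ) × (ℕ → Bool)) => c b * if un n (v b) < p.1 k then 1 else 0)
      (fun b k => (Measurable.ite (measurableSet_lt measurable_const
        ((measurable_pi_apply k).comp measurable_fst)) measurable_const
          measurable_const).const_mul _) _
  have hF1 : ∀ n p, |F n p| ≤ 1 := fun n p =>
    abs_prod_one_sub_le_one _
      (fun k => mul_nonneg (hc0 _) (by split_ifs <;> simp))
      fun k => mul_le_one₀ (hc1 _) (by split_ifs <;> simp) (by split_ifs <;> simp)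
  have hXp : Measurable fun ω n => X n ω := measurable_pi_lambda _ hXmeas
  have hεp : Measurable fun ω n => ε n ω := measurable_pi_lambda _ hεmeas
  have hFint : ∀ n, Integrable (fun p : Ω × Ω => F n (fun k => X k p.1, fun k => ε k p.2))
      (P.prod P) := fun n =>
    integrable_of_measurable_of_abs_le_one
      ((hFm n).comp ((hXp.comp measurable_fst).prodMk (hεp.comp measurable_snd))) fun p => hF1 _ _
  refine hlim.congr_dist ?_
  refine squeeze_zero' (Eventually.of_forall fun _ => dist_nonneg) ?_ hδ0
  filter_upwards [hδ] with n hn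
  have e1 : ∫ ω, ∏ k ∈ Finset.Icc 1 n,
      (1 - c (ε k ω) * if un n (v (ε k ω)) < X k ω then 1 else 0) ∂P =
      ∫ ω', ∫ ω, F n (fun k => X k ω, fun k => ε k ω') ∂P ∂P :=
    integral_comp_eq_of_indepFun hXp hεp hindep (hFm n) (hF1 n)
  rw [dist_comm, Real.dist_eq, e1, integral_prod _ (hKint n)]
  exact abs_integral_sub_integral_le (hFint n).integral_prod_right (hKint n).integral_prod_left
    fun ω => hn fun k => ε k ω

lemma measurable_card_filter {α ι : Type*} [MeasurableSpace α] (s : Finset ι) {p : ι → α → Prop}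
    [∀ a, DecidablePred fun i => p i a] (hp : ∀ i, MeasurableSet {a | p i a}) :
    Measurable fun a => (s.filter fun i => p i a).card := by
  simp only [Finset.card_filter]
  exact Finset.measurable_fun_sum _ fun i _ =>
    Measurable.ite (hp i) measurable_const measurable_const

lemma prod_one_sub_eq_pow_card (s : Finset ℕ) (e : ℕ → Bool) (a b x y : ℝ) (X : ℕ → ℝ) :
    ∏ k ∈ s, (1 - (if e k then 1 - a else 1 - b) * if (if e k then x else y) < X k then 1 else 0) =
      a ^ (s.filter fun j => x < X j ∧ e j = true).card *
        b ^ (s.filter fun j => y < X j ∧ e j = false).card := by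
  rw [← Finset.prod_const, ← Finset.prod_const, Finset.prod_filter, Finset.prod_filter,
    ← Finset.prod_mul_distrib]
  refine Finset.prod_congr rfl fun k _ => ?_
  cases e k <;> simp <;> split_ifs <;> simp

lemma continuous_g (γ x : ℝ) : Continuous (g γ x) := by
  unfold g; fun_prop

theorem stmt0
    {Ω : Type} [MeasurableSpace Ω] (P : Measure Ω) [IsProbabilityMeasure P]
    (X : ℕ → Ω → ℝ) (ε : ℕ → Ω → Bool) (lam : Ω → ℝ) (γ : ℝ)
    (hγ : 0 ≤ γ)
    (hXmeas : ∀ n, Measurable (X n))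
    (hεmeas : ∀ n, Measurable (ε n))
    (hlam : Measurable lam)
    -- every finite-dimensional distribution of `X` is centered Gaussian
    (hGauss : ∀ (m : ℕ) (idx : Fin m → ℕ) (c : Fin m → ℝ), ∃ v : ℝ≥0,
      Measure.map (fun ω => ∑ i, c i * X (idx i) ω) P = gaussianReal 0 v)
    -- each `X n` is standard Gaussian
    (hstd : ∀ n, Measure.map (X n) P = gaussianReal 0 1)
    -- stationarity
    (hstat : ∀ (m k : ℕ),
      Measure.map (fun ω => fun i : Fin m => X (i.1 + 1 + k) ω) P =
        Measure.map (fun ω => fun i : Fin m => X (i.1 + 1) ω) P)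
    -- `r_n ln n → γ`
    (hr : Tendsto (fun n : ℕ => (∫ ω, X 1 ω * X (n + 1) ω ∂P) * Real.log n)
      atTop (nhds γ))
    -- independence of the sequences `X` and `ε`
    (hindep : IndepFun (fun ω => fun n => X n ω) (fun ω => fun n => ε n ω) P)
    (hlam01 : ∀ᵐ ω ∂P, lam ω ∈ Set.Icc (0 : ℝ) 1)
    -- `S_n / n → λ` in probability
    (hS : TendstoInMeasure P
      (fun n ω => (∑ k ∈ Finset.Icc 1 n, (if ε k ω then (1 : ℝ) else 0)) / n)
      atTop lam)
    (k l : ℕ) (hk : 1 ≤ k) (hl : 1 ≤ l) (x y : ℝ) :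
    Tendsto (fun n : ℕ =>
      (P {ω | ((Finset.Icc 1 n).filter
            (fun j => un n x < X j ω ∧ ε j ω = true)).card ≤ k - 1 ∧
          ((Finset.Icc 1 n).filter
            (fun j => un n y < X j ω ∧ ε j ω = false)).card ≤ l - 1}).toReal)
      atTop
      (nhds (∑ s ∈ Finset.range k, ∑ t ∈ Finset.range l,
        ∫ ω, ∫ z,
          (lam ω * g γ x z) ^ s / (Nat.factorial s : ℝ) *
            Real.exp (-(lam ω * g γ x z)) *
          (((1 - lam ω) * g γ y z) ^ t / (Nat.factorial t : ℝ) *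
            Real.exp (-((1 - lam ω) * g γ y z)))
          ∂(gaussianReal 0 1) ∂P)) := by
  set Q := P.prod (gaussianReal 0 1) with hQ
  set A : Ω × ℝ → ℝ≥0 := fun p => (lam p.1 * g γ x p.2).toNNReal with hAdef
  set B : Ω × ℝ → ℝ≥0 := fun p => ((1 - lam p.1) * g γ y p.2).toNNReal with hBdef
  have hgx : Measurable fun p : Ω × ℝ => g γ x p.2 :=
    (continuous_g γ x).measurable.comp measurable_snd
  have hgy : Measurable fun p : Ω × ℝ => g γ y p.2 :=
    (continuous_g γ y).measurable.comp measurable_snd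
  have hA : Measurable A := ((hlam.comp measurable_fst).mul hgx).real_toNNReal
  have hB : Measurable B := (((hlam.comp measurable_fst).const_sub 1).mul hgy).real_toNNReal
  have hAB : ∀ᵐ p ∂Q, (A p : ℝ) = lam p.1 * g γ x p.2 ∧ (B p : ℝ) = (1 - lam p.1) * g γ y p.2 := by
    filter_upwards [Measure.quasiMeasurePreserving_fst.ae hlam01] with p hp
    exact ⟨Real.coe_toNNReal _ (mul_nonneg hp.1 (exp_pos _).le),
      Real.coe_toNNReal _ (mul_nonneg (sub_nonneg.2 hp.2) (exp_pos _).le)⟩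
  set N : ℕ → Ω → ℕ × ℕ := fun n ω =>
    (((Finset.Icc 1 n).filter fun j => un n x < X j ω ∧ ε j ω = true).card,
      ((Finset.Icc 1 n).filter fun j => un n y < X j ω ∧ ε j ω = false).card) with hNdef
  have hNm : ∀ n, Measurable (N n) := fun n =>
    (measurable_card_filter _ (p := fun j ω => un n x < X j ω ∧ ε j ω = true) fun j =>
      (measurableSet_lt measurable_const (hXmeas j)).inter
        (hεmeas j (MeasurableSet.singleton true))).prodMk
    (measurable_card_filter _ (p := fun j ω => un n y < X j ω ∧ ε j ω = false) fun j =>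
      (measurableSet_lt measurable_const (hXmeas j)).inter
        (hεmeas j (MeasurableSet.singleton false)))
  have hprob : ∀ n, IsProbabilityMeasure (P.map (N n)) := fun n =>
    Measure.isProbabilityMeasure_map (hNm n).aemeasurable
  have hprob0 := isProbabilityMeasure_mixedPoisson (Q := Q) hA hB
  have hlim := tendsto_measureReal_of_tendsto_pgf (ν := fun n => P.map (N n))
    (ν₀ := mixedPoisson Q hA hB) (fun a b ha0 ha1 hb0 hb1 => ?_) k l
  · convert hlim using 2 with n
    · rw [map_measureReal_apply (hNm n) (by measurability), Measure.real]
      congr 2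
      ext ω
      simp only [hNdef, Set.mem_preimage, Set.mem_prod, Set.mem_Iio, Set.mem_ofPred_eq]
      omega
    · rw [measureReal_mixedPoisson hA hB]
      refine Finset.sum_congr rfl fun s _ => Finset.sum_congr rfl fun t _ => ?_
      have hae : (fun p : Ω × ℝ => (A p : ℝ) ^ s / (Nat.factorial s : ℝ) * exp (-A p) *
          ((B p : ℝ) ^ t / (Nat.factorial t : ℝ) * exp (-B p))) =ᵐ[Q]
          fun p => (lam p.1 * g γ x p.2) ^ s / (Nat.factorial s : ℝ) *
            exp (-(lam p.1 * g γ x p.2)) *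
            (((1 - lam p.1) * g γ y p.2) ^ t / (Nat.factorial t : ℝ) *
              exp (-((1 - lam p.1) * g γ y p.2))) := by
        filter_upwards [hAB] with p hp
        rw [hp.1, hp.2]
      have hint : Integrable (fun p : Ω × ℝ => (A p : ℝ) ^ s / (Nat.factorial s : ℝ) *
          exp (-A p) * ((B p : ℝ) ^ t / (Nat.factorial t : ℝ) * exp (-B p))) Q := by
        refine integrable_of_measurable_of_abs_le_one (by fun_prop) fun p => ?_
        rw [abs_mul]
        exact mul_le_one₀ (abs_pow_div_factorial_mul_exp_le_one (A p).2 s) (abs_nonneg _)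
          (abs_pow_div_factorial_mul_exp_le_one (B p).2 t)
      rw [integral_congr_ae hae, hQ, integral_prod _ (hint.congr hae)]
  · have h := tendsto_integral_prod_indicator hγ hXmeas hεmeas hGauss hstd hstat hr hindep hS
      (c := fun e => if e then 1 - a else 1 - b)
      (fun e => by cases e <;> simp [ha1, hb1]) (fun e => by cases e <;> simp [ha0, hb0])
      (fun e => if e then x else y)
    rw [integral_pow_mul_pow_mixedPoisson hA hB ha0 ha1 hb0 hb1]
    convert h using 2 with n
    · rw [integral_map (hNm n).aemeasurable (Measurable.of_discrete).aestronglyMeasurable]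
      refine integral_congr_ae (ae_of_all _ fun ω => ?_)
      simp only [apply_ite (un n), hNdef]
      exact (prod_one_sub_eq_pow_card _ (fun k => ε k ω) a b (un n x) (un n y)
        fun k => X k ω).symm
    · refine integral_congr_ae ?_
      filter_upwards [hAB] with p hp
      simp only [hp.1, hp.2, if_true, Bool.false_eq_true, if_false]
      ring_nf
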